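/- Let V ⊆ V' be an extension of valuation rings such that V' is a filtered union of V-subalgebras A_i each of which is a localization of a polynomial V-algebra at a prime, and each A_i is in turn expressible so that V' is also a filtered union of complete intersection V''-subalgebras for an intermediate valuation ring V ⊆ V'' ⊆ V'. If V'' is a filtered union of its complete intersection V-subalgebras and V' is a filtered union of its complete intersection V''-subalgebras, then V' is a filtered union of its complete intersection V-subalgebras, where a complete intersection A-algebra is one of the form G/(P) with G a smooth A-algebra and P a regular sequence in G. -/

import Mathlib

universe u

/-- `B` is a *complete intersection* `A`-algebra: `B ≅ G/(P)` with `G` a smooth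
`A`-algebra and `P` a regular sequence of elements of `G`. -/
def IsCompleteIntersectionAlgebra (A : Type u) [CommRing A]
    (B : Type u) [CommRing B] [Algebra A B] : Prop :=
  ∃ (G : Type u) (_ : CommRing G) (_ : Algebra A G) (P : List G),
    Algebra.Smooth A G ∧ RingTheory.Sequence.IsRegular G P ∧
      Nonempty ((G ⧸ Ideal.span {x : G | x ∈ P}) ≃ₐ[A] B)

/-- `B` is a filtered union of its complete intersection `A`-subalgebras:
there is a nonempty directed family of `A`-subalgebras of `B`, each of which is
a complete intersection `A`-algebra, whose union is all of `B`. -/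
def IsFilteredUnionOfCISubalgebras (A : Type u) [CommRing A]
    (B : Type u) [CommRing B] [Algebra A B] : Prop :=
  ∃ (ι : Type u) (S : ι → Subalgebra A B), Nonempty ι ∧
    (∀ i j : ι, ∃ k : ι, S i ≤ S k ∧ S j ≤ S k) ∧
    (∀ x : B, ∃ i : ι, x ∈ S i) ∧
    ∀ i : ι, IsCompleteIntersectionAlgebra A (S i)

section
/-- generic Tor vanishing, in terms of ideals -/
def GenTor (R : Type*) {B : Type*} [CommRing R] [CommRing B] [Algebra R B]
    (J : Ideal R) (K : Ideal B) (s : R) : Prop :=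
  ∀ (J' : Ideal R) (_ : J ≤ J') (x : B), x ∈ J'.map (algebraMap R B) → x ∈ K →
    ∃ n : ℕ, algebraMap R B s ^ n * x ∈
      J.map (algebraMap R B) ⊔ J'.map (algebraMap R B) * K

theorem GenTor.mul {R B : Type*} [CommRing R] [CommRing B] [Algebra R B]
    {J : Ideal R} {K : Ideal B} {s : R} (h : GenTor R J K s) {s' : R} (hd : s ∣ s') :
    GenTor R J K s' := by
  intro J' hJ' x hx hxK
  obtain ⟨n, hn⟩ := h J' hJ' x hx hxK
  obtain ⟨t, rfl⟩ := hd
  refine ⟨n, ?_⟩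
  have := Ideal.mul_mem_left _ (algebraMap R B t ^ n) hn
  rw [map_mul, mul_pow]
  convert this using 1
  ring

theorem genTor_base {R : Type*} [CommRing R] (J : Ideal R) [hJ : J.IsPrime] (K : Ideal R)
    (_ : J ≤ K) : ∃ s ∉ J, GenTor R J K s := by
  by_cases h : K ≤ J
  · refine ⟨1, fun h1 => hJ.ne_top ((Ideal.eq_top_iff_one _).2 h1), fun J' _ x _ hx => ⟨0, ?_⟩⟩
    simp only [Algebra.algebraMap_self, Ideal.map_id, pow_zero, one_mul]
    exact Ideal.mem_sup_left (h hx)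
  · obtain ⟨s, hsK, hsJ⟩ := SetLike.not_le_iff_exists.1 h
    refine ⟨s, hsJ, fun J' _ x hx _ => ⟨1, ?_⟩⟩
    apply Ideal.mem_sup_right
    rw [pow_one, mul_comm _ x]
    exact Ideal.mul_mem_mul hx hsK

open Polynomial in
theorem lift_leading {B : Type*} [CommRing B] (I : Ideal B) (K : Ideal B[X]) (d : ℕ) (y : B)
    (hy : y ∈ I * K.leadingCoeffNth d) :
    ∃ p ∈ I.map C * K, p.degree ≤ d ∧ p.coeff d = y := by
  refine Submodule.mul_induction_on hy ?_ ?_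
  · intro a ha l hl
    obtain ⟨p, hp, rfl⟩ := (Submodule.mem_map).1 hl
    have hp' := (Submodule.mem_inf.1 hp)
    refine ⟨C a * p, Ideal.mul_mem_mul (Ideal.mem_map_of_mem _ ha) hp'.2, ?_, by simp⟩
    exact (Polynomial.degree_mul_le _ _).trans ((add_le_add degree_C_le (mem_degreeLE.1 hp'.1)).trans (by simp))
  · rintro x z ⟨p, hp, hpd, rfl⟩ ⟨q, hq, hqd, rfl⟩
    exact ⟨p + q, Ideal.add_mem _ hp hq, (degree_add_le _ _).trans (max_le hpd hqd), by simp⟩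

theorem mem_and_of_mem_mul {B : Type*} [CommRing B] {I K : Ideal B} {p : B} (hp : p ∈ I * K) :
    p ∈ I ∧ p ∈ K := Ideal.mem_inf.1 (Ideal.mul_le_inf hp)

open Polynomial in
theorem genTor_step {R B : Type*} [CommRing R] [CommRing B] [Algebra R B] [IsNoetherianRing B]
    (J : Ideal R) [hJ : J.IsPrime]
    (h : ∀ K : Ideal B, J.map (algebraMap R B) ≤ K → ∃ s ∉ J, GenTor R J K s)
    (K : Ideal B[X]) (hK : J.map (algebraMap R B[X]) ≤ K) : ∃ s ∉ J, GenTor R J K s := by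
  classical
  have hmap : ∀ I : Ideal R, I.map (algebraMap R B[X]) = (I.map (algebraMap R B)).map C := by
    intro I
    rw [Ideal.map_map]; rfl
  have hL : ∀ d, J.map (algebraMap R B) ≤ K.leadingCoeffNth d := by
    intro d y hy
    refine Submodule.mem_map.2 ⟨C y * X ^ d, Submodule.mem_inf.2 ⟨mem_degreeLE.2 (degree_C_mul_X_pow_le _ _), ?_⟩, by simp⟩
    have hy' : C y ∈ J.map (algebraMap R B[X]) := by
      rw [hmap]; exact Ideal.mem_map_of_mem _ hy
    have hy2 : C y * X ^ d ∈ K := Ideal.mul_mem_right _ _ (hK hy')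
    exact hy2
  choose s hsJ hs using fun d => h _ (hL d)
  obtain ⟨N, hN⟩ := monotone_stabilizes_iff_noetherian.2 (inferInstanceAs (IsNoetherian B B))
    ⟨K.leadingCoeffNth, fun _ _ H => K.leadingCoeffNth_mono H⟩
  obtain ⟨σ, hσJ, hσ⟩ : ∃ σ ∉ J, ∀ d, GenTor R J (K.leadingCoeffNth d) σ := by
    let σ := ∏ i ∈ Finset.range (N + 1), s i
    have hσJ : σ ∉ J := by
      intro hmem
      obtain ⟨i, -, hi⟩ := (hJ.prod_mem_iff).1 hmem
      exact hsJ i hi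
    have hσ : ∀ d, GenTor R J (K.leadingCoeffNth d) σ := by
      intro d
      rcases le_total d N with hd | hd
      · exact (hs d).mul (Finset.dvd_prod_of_mem _ (by simp; omega))
      · have := hN d hd
        change K.leadingCoeffNth N = K.leadingCoeffNth d at this
        rw [← this]
        exact (hs N).mul (Finset.dvd_prod_of_mem _ (by simp))
    exact ⟨σ, hσJ, hσ⟩
  refine ⟨σ, hσJ, fun J' hJ' => ?_⟩
  have key : ∀ d : ℕ, ∀ x : B[X], x.degree < d → x ∈ J'.map (algebraMap R B[X]) → x ∈ K →
      ∃ n : ℕ, algebraMap R B[X] σ ^ n * x ∈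
        J.map (algebraMap R B[X]) ⊔ J'.map (algebraMap R B[X]) * K := by
    intro d
    induction d with
    | zero =>
      intro x hx _ _
      have : x = 0 := by
        rw [← degree_eq_bot]; exact Nat.WithBot.lt_zero_iff.1 hx
      exact ⟨0, by simp [this]⟩
    | succ d ih =>
      intro x hx hxJ hxK
      have hxd : x.degree ≤ d := by
        have : x.natDegree < d + 1 ∨ x = 0 := by
          by_cases h0 : x = 0
          · exact Or.inr h0
          · exact Or.inl ((natDegree_lt_iff_degree_lt h0).2 hx)
        rcases this with h | h
        · exact natDegree_le_iff_degree_le.1 (by omega)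
        · simp [h]
      have h1 : x.coeff d ∈ J'.map (algebraMap R B) := by
        rw [hmap] at hxJ
        exact Ideal.mem_map_C_iff.1 hxJ d
      have h2 : x.coeff d ∈ K.leadingCoeffNth d :=
        Submodule.mem_map.2 ⟨x, Submodule.mem_inf.2 ⟨mem_degreeLE.2 hxd, hxK⟩, by simp⟩
      obtain ⟨n, hn⟩ := hσ d J' hJ' _ h1 h2
      obtain ⟨j, hj, y, hy, hjy⟩ := Submodule.mem_sup.1 hn
      obtain ⟨p, hp, hpd, hpc⟩ := lift_leading _ K d y hy
      rw [← hmap] at hp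
      replace hp := (⟨(mem_and_of_mem_mul hp).1, (mem_and_of_mem_mul hp).2, hp⟩ : _ ∧ _ ∧ _)
      have hjJ : C j * X ^ d ∈ J.map (algebraMap R B[X]) :=
        Ideal.mul_mem_right _ _ (by rw [hmap]; exact Ideal.mem_map_of_mem _ hj)
      have hσC : algebraMap R B[X] σ = C (algebraMap R B σ) := rfl
      have ih' := ih (algebraMap R B[X] σ ^ n * x - C j * X ^ d - p) ?_ ?_ ?_
      · obtain ⟨k, hk⟩ := ih'
        refine ⟨k + n, ?_⟩
        have e : algebraMap R B[X] σ ^ (k + n) * x =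
            algebraMap R B[X] σ ^ k * (algebraMap R B[X] σ ^ n * x - C j * X ^ d - p) +
              (algebraMap R B[X] σ ^ k * (C j * X ^ d) + algebraMap R B[X] σ ^ k * p) := by
          ring
        rw [e]
        refine Ideal.add_mem _ hk (Ideal.add_mem _ ?_ ?_)
        · exact Ideal.mem_sup_left (Ideal.mul_mem_left _ _ hjJ)
        · exact Ideal.mem_sup_right (Ideal.mul_mem_left _ _ hp.2.2)
      · rw [degree_lt_iff_coeff_zero]
        intro m hm
        rw [hσC, ← C_pow, coeff_sub, coeff_sub, coeff_C_mul, coeff_C_mul, coeff_X_pow]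
        rcases hm.eq_or_lt with rfl | hm
        · simp only [if_true, mul_one, hpc]
          rw [← hjy]; ring
        · have hm' : (d : WithBot ℕ) < m := by exact_mod_cast hm
          rw [coeff_eq_zero_of_degree_lt (hxd.trans_lt hm'),
            coeff_eq_zero_of_degree_lt (hpd.trans_lt hm'), if_neg (by omega)]
          simp
      · have hp1 : p ∈ J'.map (algebraMap R B[X]) := hp.1
        have hx1 : algebraMap R B[X] σ ^ n * x ∈ J'.map (algebraMap R B[X]) :=
          Ideal.mul_mem_left _ _ hxJ
        have hj1 : C j * X ^ d ∈ J'.map (algebraMap R B[X]) := Ideal.map_mono hJ' hjJ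
        exact Ideal.sub_mem _ (Ideal.sub_mem _ hx1 hj1) hp1
      · have hp1 : p ∈ K := hp.2.1
        have hx1 : algebraMap R B[X] σ ^ n * x ∈ K := Ideal.mul_mem_left _ _ hxK
        have hj1 : C j * X ^ d ∈ K := hK hjJ
        exact Ideal.sub_mem _ (Ideal.sub_mem _ hx1 hj1) hp1
  intro x hx hxK
  exact key (x.natDegree + 1) x (lt_of_le_of_lt degree_le_natDegree (by exact_mod_cast Nat.lt_succ_self _)) hx hxK

theorem GenTor.of_equiv {R B C : Type*} [CommRing R] [CommRing B] [CommRing C] [Algebra R B]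
    [Algebra R C] (e : B ≃ₐ[R] C) {J : Ideal R} {K : Ideal C} {s : R}
    (h : GenTor R J (K.comap (e : B →+* C)) s) : GenTor R J K s := by
  have hm : ∀ I : Ideal R, (I.map (algebraMap R B)).map (e : B →+* C) = I.map (algebraMap R C) := by
    intro I
    rw [Ideal.map_map]
    congr 1
    ext x; simp
  have hKm : (K.comap (e : B →+* C)).map (e : B →+* C) = K :=
    Ideal.map_comap_of_surjective _ e.surjective K
  intro J' hJ' x hx hxK
  have hx' : e.symm x ∈ J'.map (algebraMap R B) := by
    have : e.symm x ∈ (J'.map (algebraMap R C)).map ((e.symm : C ≃ₐ[R] B) : C →+* B) :=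
      Ideal.mem_map_of_mem _ hx
    rw [Ideal.map_map] at this
    convert this using 2
    ext x; simp
  obtain ⟨n, hn⟩ := h J' hJ' (e.symm x) hx' (by simpa [Ideal.mem_comap] using hxK)
  refine ⟨n, ?_⟩
  have := Ideal.mem_map_of_mem (e : B →+* C) hn
  rw [Ideal.map_sup, Ideal.map_mul, hm, hm, hKm] at this
  simpa using this

theorem genTor_mvPolynomial {R : Type*} [CommRing R] [IsNoetherianRing R]
    (J : Ideal R) [hJ : J.IsPrime] (m : ℕ) :
    ∀ (K : Ideal (MvPolynomial (Fin m) R)),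
      J.map (algebraMap R (MvPolynomial (Fin m) R)) ≤ K → ∃ s ∉ J, GenTor R J K s := by
  have tr : ∀ {B C : Type _} [CommRing B] [CommRing C] [Algebra R B] [Algebra R C]
      (e : B ≃ₐ[R] C) (_ : ∀ K : Ideal B, J.map (algebraMap R B) ≤ K → ∃ s ∉ J, GenTor R J K s)
      (K : Ideal C), J.map (algebraMap R C) ≤ K → ∃ s ∉ J, GenTor R J K s := by
    intro B C _ _ _ _ e h K hK
    obtain ⟨s, hs, hs'⟩ := h (K.comap (e : B →+* C)) (by
      rw [← Ideal.map_le_iff_le_comap, Ideal.map_map]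
      convert hK using 2
      ext x; simp)
    exact ⟨s, hs, hs'.of_equiv e⟩
  induction m with
  | zero =>
    exact tr (MvPolynomial.isEmptyAlgEquiv R (Fin 0)).symm (fun K hK => genTor_base J K (by simpa using hK))
  | succ m ih =>
    exact tr (MvPolynomial.finSuccEquiv R m).symm (genTor_step J ih)
end

section
theorem krull_local {B : Type*} [CommRing B] [IsNoetherianRing B] (q : Ideal B) [q.IsPrime]
    (P A : Ideal B) (hP : P ≤ q) (b : B)
    (h : ∀ n : ℕ, ∃ t ∈ q.primeCompl, t * b ∈ A ⊔ P ^ n) : ∃ t ∈ q.primeCompl, t * b ∈ A := by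
  let O := Localization.AtPrime q
  have : IsNoetherianRing O := IsLocalization.isNoetherianRing q.primeCompl O inferInstance
  have hne : P.map (algebraMap B O) ≠ ⊤ := by
    intro htop
    have h1 : algebraMap B O 1 ∈ P.map (algebraMap B O) := htop ▸ trivial
    obtain ⟨m, hm, hm'⟩ := (IsLocalization.algebraMap_mem_map_algebraMap_iff q.primeCompl O P 1).1 h1
    exact hm (hP (by simpa using hm'))
  have hK := Ideal.iInf_pow_smul_eq_bot_of_isLocalRing (M := O ⧸ A.map (algebraMap B O))
    (P.map (algebraMap B O)) hne
  rw [← IsLocalization.algebraMap_mem_map_algebraMap_iff q.primeCompl O A b,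
    ← Ideal.Quotient.eq_zero_iff_mem, ← Submodule.mem_bot O, ← hK, Submodule.mem_iInf]
  intro n
  have hb := (IsLocalization.algebraMap_mem_map_algebraMap_iff q.primeCompl O _ b).2 (h n)
  rw [Ideal.map_sup, Ideal.map_pow] at hb
  obtain ⟨x, hx, y, hy, hxy⟩ := Submodule.mem_sup.1 hb
  rw [← hxy, map_add, Ideal.Quotient.eq_zero_iff_mem.2 hx, zero_add]
  have : Ideal.Quotient.mk (A.map (algebraMap B O)) y = y • (1 : O ⧸ A.map (algebraMap B O)) := by
    change _ = Ideal.Quotient.mk _ (y * 1)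
    rw [mul_one]
  rw [this]
  exact Submodule.smul_mem_smul hy trivial

section
variable {R B : Type*} [CommRing R] [CommRing B] [Algebra R B]

/-- `f` is a nonzerodivisor on `B/(JB+I)` up to elements of `M`. -/
def Gd (R : Type*) {B : Type*} [CommRing R] [CommRing B] [Algebra R B]
    (M : Submonoid B) (I : Ideal B) (f : B) (J : Ideal R) : Prop :=
  ∀ b, f * b ∈ J.map (algebraMap R B) ⊔ I → ∃ t ∈ M, t * b ∈ J.map (algebraMap R B) ⊔ I

/-- `B/I` is flat over `R` up to elements of `M` (colon formulation). -/
def CP (R : Type*) {B : Type*} [CommRing R] [CommRing B] [Algebra R B]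
    (M : Submonoid B) (I : Ideal B) : Prop :=
  ∀ (J : Ideal R) (a : R) (c : B), algebraMap R B a * c ∈ J.map (algebraMap R B) ⊔ I →
    ∃ t ∈ M, t * c ∈ (Submodule.colon J {a} : Ideal R).map (algebraMap R B) ⊔ I

theorem noeth_ind {A : Type*} [CommRing A] [IsNoetherianRing A] {P : Ideal A → Prop}
    (h : ∀ I : Ideal A, (∀ J > I, P J) → P I) (I : Ideal A) : P I := IsNoetherian.induction h I

theorem map_sup_mono {J J' : Ideal R} (h : J ≤ J') {I : Ideal B} {x : B}
    (hx : x ∈ J.map (algebraMap R B) ⊔ I) : x ∈ J'.map (algebraMap R B) ⊔ I := by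
  have : J.map (algebraMap R B) ⊔ I ≤ J'.map (algebraMap R B) ⊔ I :=
    sup_le (le_trans (Ideal.map_mono h) le_sup_left) le_sup_right
  exact this hx

theorem Gd.mono {M M' : Submonoid B} (hM : M ≤ M') {I : Ideal B} {f : B} {J : Ideal R}
    (h : Gd R M I f J) : Gd R M' I f J := fun b hb => by
  obtain ⟨t, ht, h'⟩ := h b hb
  exact ⟨t, hM ht, h'⟩

theorem Gd.dvd {h h' : B} (hd : h ∣ h') {I : Ideal B} {f : B} {J : Ideal R}
    (hG : Gd R (Submonoid.powers h) I f J) : Gd R (Submonoid.powers h') I f J := fun b hb => by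
  obtain ⟨_, ⟨n, rfl⟩, h'⟩ := hG b hb
  obtain ⟨k, rfl⟩ := hd
  refine ⟨_, ⟨n, rfl⟩, ?_⟩
  simp only at h' ⊢
  rw [mul_pow, mul_comm (h ^ n), mul_assoc]
  exact Ideal.mul_mem_left _ _ h'

theorem CP.mono {M M' : Submonoid B} (hM : M ≤ M') {I : Ideal B}
    (h : CP R M I) : CP R M' I := fun J a b hb => by
  obtain ⟨t, ht, h'⟩ := h J a b hb
  exact ⟨t, hM ht, h'⟩

theorem CP.dvd {h h' : B} (hd : h ∣ h') {I : Ideal B}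
    (hG : CP R (Submonoid.powers h) I) : CP R (Submonoid.powers h') I := fun J a b hb => by
  obtain ⟨_, ⟨n, rfl⟩, h'⟩ := hG J a b hb
  obtain ⟨k, rfl⟩ := hd
  refine ⟨_, ⟨n, rfl⟩, ?_⟩
  simp only at h' ⊢
  rw [mul_pow, mul_comm (h ^ n), mul_assoc]
  exact Ideal.mul_mem_left _ _ h'

theorem mem_sup_span {J : Ideal R} {a : R} {I : Ideal B} {x : B}
    (hx : x ∈ (J ⊔ Ideal.span {a}).map (algebraMap R B) ⊔ I) :
    ∃ y c, y ∈ J.map (algebraMap R B) ⊔ I ∧ x = y + algebraMap R B a * c := by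
  rw [Ideal.map_sup, Ideal.map_span, Set.image_singleton, sup_assoc, sup_comm (Ideal.span _) I, ← sup_assoc,
    sup_comm] at hx
  obtain ⟨c, y, hy, h⟩ := Ideal.mem_span_singleton_sup.1 hx
  exact ⟨y, c, hy, by rw [← h]; ring⟩

theorem mul_colon {J : Ideal R} {a : R} {I : Ideal B} {x : B}
    (hx : x ∈ (Submodule.colon J {a} : Ideal R).map (algebraMap R B) ⊔ I) :
    algebraMap R B a * x ∈ J.map (algebraMap R B) ⊔ I := by
  obtain ⟨y, hy, z, hz, rfl⟩ := Submodule.mem_sup.1 hx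
  rw [mul_add]
  refine Ideal.add_mem _ (Ideal.mem_sup_left ?_) (Ideal.mem_sup_right (Ideal.mul_mem_left _ _ hz))
  have : algebraMap R B a * y ∈ Ideal.span {algebraMap R B a} *
    (Submodule.colon J {a} : Ideal R).map (algebraMap R B) :=
    Ideal.mul_mem_mul (Ideal.mem_span_singleton_self _) hy
  rw [← Set.image_singleton, ← Ideal.map_span, ← Ideal.map_mul] at this
  refine Ideal.map_mono ?_ this
  rw [Ideal.span_singleton_mul_le_iff]
  intro r hr
  rw [mul_comm]
  exact Submodule.mem_colon_singleton.1 hr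

theorem Gd.of_colon {M : Submonoid B} {I : Ideal B} {f : B} (hM : CP R M I) {J : Ideal R} (a : R)
    (h1 : Gd R M I f (J ⊔ Ideal.span {a})) (h2 : Gd R M I f (Submodule.colon J {a})) :
    Gd R M I f J := by
  intro b hb
  obtain ⟨t₁, ht₁, h⟩ := h1 b (map_sup_mono le_sup_left hb)
  obtain ⟨x, c, hx, hxc⟩ := mem_sup_span h
  have h3 : algebraMap R B a * (f * c) ∈ J.map (algebraMap R B) ⊔ I := by
    have : algebraMap R B a * (f * c) = t₁ * (f * b) - f * x := by
      linear_combination (-f) * hxc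
    rw [this]
    exact Ideal.sub_mem _ (Ideal.mul_mem_left _ _ hb) (Ideal.mul_mem_left _ _ hx)
  obtain ⟨t₂, ht₂, h4⟩ := hM _ _ _ h3
  obtain ⟨t₃, ht₃, h5⟩ := h2 (t₂ * c) (by convert h4 using 1; ring)
  refine ⟨t₃ * t₂ * t₁, M.mul_mem (M.mul_mem ht₃ ht₂) ht₁, ?_⟩
  have : t₃ * t₂ * t₁ * b = t₃ * t₂ * x + algebraMap R B a * (t₃ * (t₂ * c)) := by
    linear_combination t₃ * t₂ * hxc
  rw [this]
  exact Ideal.add_mem _ (Ideal.mul_mem_left _ _ hx) (mul_colon h5)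

theorem le_colon (J : Ideal R) (a : R) : J ≤ Submodule.colon J {a} := fun x hx =>
  Submodule.mem_colon_singleton.2 (J.mul_mem_right a hx)

theorem Gd.of_not_le {q : Ideal B} [q.IsPrime] {I : Ideal B} {f : B} {J : Ideal R} {s : R}
    (hs : s ∈ J) : Gd R (Submonoid.powers (algebraMap R B s)) I f J := fun b _ =>
  ⟨_, ⟨1, rfl⟩, Ideal.mem_sup_left (by
    simp only [pow_one]; exact Ideal.mul_mem_right _ _ (Ideal.mem_map_of_mem _ hs))⟩

/-- local criterion -/
theorem Gd.local_criterion [IsNoetherianRing R] [IsNoetherianRing B] (q : Ideal B) [hq : q.IsPrime]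
    {I : Ideal B} {f : B} (hC : CP R q.primeCompl I)
    (h : Gd R q.primeCompl I f (q.comap (algebraMap R B))) (J : Ideal R) :
    Gd R q.primeCompl I f J := by
  set p := q.comap (algebraMap R B) with hp
  have hnot : ∀ J : Ideal R, ¬ J ≤ p → Gd R q.primeCompl I f J := by
    intro J hJ
    obtain ⟨s, hsJ, hs⟩ := SetLike.not_le_iff_exists.1 hJ
    exact (Gd.of_not_le (q := q) hsJ).mono (Submonoid.powers_le.2 hs)
  have key : ∀ n : ℕ, ∀ J : Ideal R, p ^ n ≤ J → Gd R q.primeCompl I f J := by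
    intro n J
    induction J using noeth_ind with
    | _ J ih =>
    intro hnJ
    by_cases hpJ : p ≤ J
    · by_cases hJp : J ≤ p
      · rw [le_antisymm hJp hpJ]; exact h
      · exact hnot J hJp
    · obtain ⟨a, hap, haJ⟩ := SetLike.not_le_iff_exists.1 hpJ
      refine Gd.of_colon hC a (ih _ ?_ (hnJ.trans le_sup_left)) (ih _ ?_ (hnJ.trans (le_colon _ _)))
      · exact lt_of_le_of_ne le_sup_left fun he =>
          haJ (he ▸ Ideal.mem_sup_right (Ideal.mem_span_singleton_self a))
      · refine lt_of_le_of_ne (le_colon _ _) fun he => ?_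
        have : ∀ k : ℕ, a ^ k ∈ J → a ∈ J ∨ (1 : R) ∈ J := by
          intro k
          induction k with
          | zero => intro hk; right; simpa using hk
          | succ k ihk =>
            intro hk
            apply ihk
            rw [he]
            exact Submodule.mem_colon_singleton.2 (by simpa [pow_succ] using hk)
        rcases this n (hnJ (Ideal.pow_mem_pow hap n)) with h | h
        · exact haJ h
        · exact haJ (by simpa using J.mul_mem_left a h)
  intro b hb
  refine krull_local q (p.map (algebraMap R B)) _ (Ideal.map_comap_le) b fun n => ?_
  obtain ⟨t, ht, h'⟩ := key n (J ⊔ p ^ n) le_sup_right b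
    (map_sup_mono le_sup_left hb)
  refine ⟨t, ht, ?_⟩
  rw [Ideal.map_sup, Ideal.map_pow] at h'
  convert h' using 1
  ac_rfl

theorem uniform_of_local [IsNoetherianRing B] (q : Ideal B) [hq : q.IsPrime] (A : Ideal B) (f : B)
    (h : ∀ b, f * b ∈ A → ∃ t ∈ q.primeCompl, t * b ∈ A) :
    ∃ t ∈ q.primeCompl, ∀ b, f * b ∈ A → t * b ∈ A := by
  classical
  obtain ⟨S, hS⟩ := (IsNoetherian.noetherian (Submodule.colon A {f} : Ideal B))
  have hb : ∀ b : S, ∃ t ∈ q.primeCompl, t * b ∈ A := fun b => h b (by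
    have : (b : B) ∈ (Submodule.colon A {f} : Ideal B) := hS ▸ Submodule.subset_span b.2
    rw [mul_comm]; exact Submodule.mem_colon_singleton.1 this)
  choose t ht ht' using hb
  refine ⟨∏ b : S, t b, Submonoid.prod_mem _ fun b _ => ht b, fun b hb => ?_⟩
  have hb' : b ∈ Submodule.span B (S : Set B) := by
    rw [hS]; exact Submodule.mem_colon_singleton.2 (by rw [smul_eq_mul, mul_comm]; exact hb)
  have hle : Submodule.span B (S : Set B) ≤ (Submodule.colon A {∏ b : S, t b} : Ideal B) := by
    rw [Submodule.span_le]
    intro x hx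
    refine Submodule.mem_colon_singleton.2 ?_
    obtain ⟨k, hk⟩ := Finset.dvd_prod_of_mem t (Finset.mem_univ (⟨x, hx⟩ : S))
    rw [hk, smul_eq_mul]
    have := A.mul_mem_left k (ht' ⟨x, hx⟩)
    convert this using 1
    ring
  have := Submodule.mem_colon_singleton.1 (hle hb')
  rwa [smul_eq_mul, mul_comm] at this

theorem U1 [IsNoetherianRing R] [IsNoetherianRing B]
    (hgen : ∀ (J : Ideal R) [J.IsPrime] (K : Ideal B), J.map (algebraMap R B) ≤ K →
      ∃ s ∉ J, GenTor R J K s)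
    (q : Ideal B) [hq : q.IsPrime] {I : Ideal B} {f h₀ : B} (hh₀ : h₀ ∉ q)
    (hC : CP R (Submonoid.powers h₀) I)
    (hf : Gd R q.primeCompl I f (q.comap (algebraMap R B))) :
    ∃ h ∉ q, h₀ ∣ h ∧ ∀ J : Ideal R, Gd R (Submonoid.powers h) I f J := by
  have hCq : CP R q.primeCompl I := hC.mono (Submonoid.powers_le.2 hh₀)
  have main : ∀ J : Ideal R, ∃ h ∉ q, h₀ ∣ h ∧ ∀ J' : Ideal R, J ≤ J' →
      Gd R (Submonoid.powers h) I f J' := by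
    intro J
    induction J using noeth_ind with
    | _ J ih =>
    by_cases hJ : J.IsPrime
    · obtain ⟨h₁, hh₁, hb₁⟩ := uniform_of_local q (J.map (algebraMap R B) ⊔ I) f
        (hf.local_criterion q hCq J)
      obtain ⟨s, hs, hgs⟩ := hgen J (J.map (algebraMap R B) ⊔ I ⊔ Ideal.span {f})
        (le_sup_left.trans le_sup_left)
      have hlt : J < J ⊔ Ideal.span {s} := lt_of_le_of_ne le_sup_left fun he =>
          hs (he ▸ Ideal.mem_sup_right (Ideal.mem_span_singleton_self s))
      obtain ⟨h₂, hh₂, hd₂, hb₂⟩ := ih _ hlt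
      have hCh : CP R (Submonoid.powers (h₁ * h₂)) I := hC.dvd (hd₂.mul_left _)
      refine ⟨h₁ * h₂, fun hmem => (hq.mem_or_mem hmem).elim hh₁ hh₂, hd₂.mul_left _, ?_⟩
      intro J'
      induction J' using noeth_ind with
      | _ J' ih' =>
      intro hJJ'
      by_cases hsJ' : s ∈ J'
      · exact (hb₂ J' (sup_le hJJ' ((Ideal.span_singleton_le_iff_mem _).2 hsJ'))).dvd
          (Dvd.intro_left _ rfl)
      have hlt' : J' < J' ⊔ Ideal.span {s} := lt_of_le_of_ne le_sup_left fun he =>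
          hsJ' (he ▸ Ideal.mem_sup_right (Ideal.mem_span_singleton_self s))
      by_cases hcol : Submodule.colon J' {s} = J'
      · -- case of a nonzerodivisor
        intro b hb
        obtain ⟨x, hx, i, hi, hxi⟩ := Submodule.mem_sup.1 hb
        obtain ⟨n, hn⟩ := hgs J' hJJ' x hx (by
          have : x = f * b - i := by rw [← hxi]; ring
          rw [this]
          refine Ideal.sub_mem _ (Ideal.mem_sup_right ?_) (Ideal.mem_sup_left (Ideal.mem_sup_right hi))
          exact Ideal.mul_mem_right _ _ (Ideal.mem_span_singleton_self f))
        have hn2 : algebraMap R B s ^ n * x ∈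
            (J.map (algebraMap R B) ⊔ I) ⊔ J'.map (algebraMap R B) * Ideal.span {f} := by
          obtain ⟨u, hu, v, hv, huv⟩ := Submodule.mem_sup.1 hn
          rw [Ideal.mul_sup] at hv
          obtain ⟨v₁, hv₁, v₂, hv₂, rfl⟩ := Submodule.mem_sup.1 hv
          rw [← huv, ← add_assoc]
          exact Ideal.add_mem _ (Ideal.add_mem _ (Ideal.mem_sup_left (Ideal.mem_sup_left hu))
            (Ideal.mem_sup_left (mem_and_of_mem_mul hv₁).2)) (Ideal.mem_sup_right hv₂)
        obtain ⟨w, hw, v, hv, hwv⟩ := Submodule.mem_sup.1 hn2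
        obtain ⟨z, hz, rfl⟩ := Ideal.mem_mul_span_singleton.1 hv
        have h1 := hb₁ (algebraMap R B s ^ n * b - z) (by
          have : f * (algebraMap R B s ^ n * b - z) = w + algebraMap R B s ^ n * i := by
            linear_combination (-algebraMap R B s ^ n) * hxi - hwv
          rw [this]
          exact Ideal.add_mem _ hw (Ideal.mem_sup_right (Ideal.mul_mem_left _ _ hi)))
        have h2 : algebraMap R B s ^ n * (h₁ * b) ∈ J'.map (algebraMap R B) ⊔ I := by
          have : algebraMap R B s ^ n * (h₁ * b) = h₁ * (algebraMap R B s ^ n * b - z) + h₁ * z := by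
            ring
          rw [this]
          exact Ideal.add_mem _ (map_sup_mono hJJ' h1)
            (Ideal.mem_sup_left (Ideal.mul_mem_left _ _ hz))
        have h3 : ∀ n : ℕ, ∀ c, algebraMap R B s ^ n * c ∈ J'.map (algebraMap R B) ⊔ I →
            ∃ t ∈ Submonoid.powers (h₁ * h₂), t * c ∈ J'.map (algebraMap R B) ⊔ I := by
          intro n
          induction n with
          | zero => intro c hc; exact ⟨1, Submonoid.one_mem _, by simpa using hc⟩
          | succ n ihn =>
            intro c hc
            obtain ⟨t, ht, h⟩ := hCh J' s (algebraMap R B s ^ n * c)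
              (by convert hc using 1; ring)
            rw [hcol] at h
            obtain ⟨t', ht', h'⟩ := ihn (t * c) (by convert h using 1; ring)
            exact ⟨t' * t, Submonoid.mul_mem _ ht' ht, by convert h' using 1; ring⟩
        obtain ⟨t, ht, h⟩ := h3 n _ h2
        refine ⟨t * (h₁ * h₂), Submonoid.mul_mem _ ht (Submonoid.mem_powers _), ?_⟩
        have := Ideal.mul_mem_left _ h₂ h
        convert this using 1
        ring
      · exact Gd.of_colon hCh s (ih' _ hlt' (hJJ'.trans le_sup_left))
          (ih' _ (lt_of_le_of_ne (le_colon _ _) (Ne.symm hcol)) (hJJ'.trans (le_colon _ _)))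
    · rcases Ideal.not_isPrime_iff.1 hJ with rfl | ⟨a, ha, b, hb, hab⟩
      · refine ⟨h₀, hh₀, dvd_rfl, fun J' hJ' b _ => ⟨1, Submonoid.one_mem _, ?_⟩⟩
        rw [top_le_iff.1 hJ', Ideal.map_top, top_sup_eq]
        trivial
      · obtain ⟨h₁, hh₁, hd₁, hb₁⟩ := ih (J ⊔ Ideal.span {a}) (lt_of_le_of_ne le_sup_left fun he =>
          ha (he ▸ Ideal.mem_sup_right (Ideal.mem_span_singleton_self a)))
        obtain ⟨h₂, hh₂, hd₂, hb₂⟩ := ih (J ⊔ Ideal.span {b}) (lt_of_le_of_ne le_sup_left fun he =>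
          hb (he ▸ Ideal.mem_sup_right (Ideal.mem_span_singleton_self b)))
        refine ⟨h₁ * h₂, fun hmem => (hq.mem_or_mem hmem).elim hh₁ hh₂, hd₂.mul_left _, ?_⟩
        intro J' hJ'
        refine Gd.of_colon (hC.dvd (hd₂.mul_left _)) a
          ((hb₁ _ (sup_le_sup_right hJ' _)).dvd (Dvd.intro _ rfl))
          ((hb₂ _ (sup_le (hJ'.trans (le_colon _ _)) ?_)).dvd (Dvd.intro_left _ rfl))
        rw [Ideal.span_singleton_le_iff_mem]
        exact Submodule.mem_colon_singleton.2 (hJ' (by simpa [mul_comm] using hab))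
  obtain ⟨h, hh, hd, hb⟩ := main ⊥
  exact ⟨h, hh, hd, fun J => hb J bot_le⟩

theorem CP.sup_span {M : Submonoid B} {I : Ideal B} {f : B} (hC : CP R M I)
    (hf : ∀ J : Ideal R, Gd R M I f J) : CP R M (I ⊔ Ideal.span {f}) := by
  intro J a c hc
  rw [← sup_assoc, sup_comm _ (Ideal.span _)] at hc
  obtain ⟨d, y, hy, hdy⟩ := Ideal.mem_span_singleton_sup.1 hc
  obtain ⟨t, ht, h⟩ := hf (J ⊔ Ideal.span {a}) d (by
    have : f * d = algebraMap R B a * c - y := by rw [← hdy]; ring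
    rw [this]
    refine Ideal.sub_mem _ (Ideal.mem_sup_left (Ideal.mul_mem_right _ _ (Ideal.mem_map_of_mem _
      (Ideal.mem_sup_right (Ideal.mem_span_singleton_self a))))) ?_
    exact map_sup_mono le_sup_left hy)
  obtain ⟨x, e, hx, hxe⟩ := mem_sup_span h
  obtain ⟨t', ht', h'⟩ := hC J a (t * c - f * e) (by
    have : algebraMap R B a * (t * c - f * e) = t * y + f * x := by
      linear_combination (-t) * hdy + f * hxe
    rw [this]
    exact Ideal.add_mem _ (Ideal.mul_mem_left _ _ hy) (Ideal.mul_mem_left _ _ hx))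
  refine ⟨t' * t, M.mul_mem ht' ht, ?_⟩
  have : t' * t * c = t' * (t * c - f * e) + t' * e * f := by ring
  rw [this, ← sup_assoc]
  exact Ideal.add_mem _ (Ideal.mem_sup_left h')
    (Ideal.mem_sup_right (Ideal.mul_mem_left _ _ (Ideal.mem_span_singleton_self f)))

/-- list version -/
theorem Ulist [IsNoetherianRing R] [IsNoetherianRing B]
    (hgen : ∀ (J : Ideal R) [J.IsPrime] (K : Ideal B), J.map (algebraMap R B) ≤ K →
      ∃ s ∉ J, GenTor R J K s)
    (q : Ideal B) [hq : q.IsPrime] (fs : List B) : ∀ (I : Ideal B) (h₀ : B) (_ : h₀ ∉ q)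
    (_ : CP R (Submonoid.powers h₀) I)
    (_ : ∀ (l₁ : List B) (f : B) (l₂ : List B), fs = l₁ ++ f :: l₂ →
      Gd R q.primeCompl (I ⊔ Ideal.ofList l₁) f (q.comap (algebraMap R B))),
    ∃ h ∉ q, h₀ ∣ h ∧ CP R (Submonoid.powers h) (I ⊔ Ideal.ofList fs) ∧
      ∀ (l₁ : List B) (f : B) (l₂ : List B), fs = l₁ ++ f :: l₂ →
      CP R (Submonoid.powers h) (I ⊔ Ideal.ofList l₁) ∧
        ∀ J : Ideal R, Gd R (Submonoid.powers h) (I ⊔ Ideal.ofList l₁) f J := by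
  induction fs with
  | nil =>
    intro I h₀ hh₀ hC _
    exact ⟨h₀, hh₀, dvd_rfl, by simpa using hC, by simp⟩
  | cons f fs ih =>
    intro I h₀ hh₀ hC hf
    obtain ⟨h₁, hh₁, hd₁, hG⟩ := U1 hgen q hh₀ hC (by simpa using hf [] f fs rfl)
    have hC₁ := (hC.dvd hd₁).sup_span hG
    obtain ⟨h, hh, hd, hCh, hall⟩ := ih (I ⊔ Ideal.span {f}) h₁ hh₁ hC₁ (by
      intro l₁ g l₂ he
      have := hf (f :: l₁) g l₂ (by rw [he]; rfl)
      rwa [Ideal.ofList_cons, ← sup_assoc] at this)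
    refine ⟨h, hh, hd₁.trans hd, by rwa [Ideal.ofList_cons, ← sup_assoc], ?_⟩
    intro l₁ g l₂ he
    cases l₁ with
    | nil =>
      simp only [List.nil_append, List.cons.injEq] at he
      obtain ⟨rfl, rfl⟩ := he
      simp only [Ideal.ofList_nil, sup_bot_eq]
      exact ⟨hC.dvd (hd₁.trans hd), fun J => (hG J).dvd hd⟩
    | cons f' l₁ =>
      simp only [List.cons_append, List.cons.injEq] at he
      obtain ⟨rfl, he⟩ := he
      rw [Ideal.ofList_cons, ← sup_assoc]
      exact hall l₁ g l₂ he

theorem CP.mvPolynomial {σ : Type*} (M : Submonoid (MvPolynomial σ R)) :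
    CP R M (⊥ : Ideal (MvPolynomial σ R)) := by
  intro J a c hc
  refine ⟨1, M.one_mem, ?_⟩
  rw [sup_bot_eq, MvPolynomial.algebraMap_eq] at hc ⊢
  rw [one_mul, MvPolynomial.mem_map_C_iff]
  intro d
  have := MvPolynomial.mem_map_C_iff.1 hc d
  rw [MvPolynomial.coeff_C_mul, mul_comm] at this
  exact Submodule.mem_colon_singleton.2 this

end
end

section
section
open Module
variable {R M : Type*} [CommRing R] [AddCommGroup M] [Module R M]

theorem triv_add {ι : Type*} [Fintype ι] {f : ι → R} {x x' : ι → M}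
    (h : IsTrivialRelation f x) (h' : IsTrivialRelation f x') : IsTrivialRelation f (x + x') := by
  obtain ⟨k, a, y, h1, h2⟩ := h
  obtain ⟨k', a', y', h1', h2'⟩ := h'
  refine ⟨k + k', fun i => Fin.append (a i) (a' i), Fin.append y y', fun i => ?_, fun j => ?_⟩
  · simp [Fin.sum_univ_add, h1, h1']
  · refine Fin.addCases (fun j => ?_) (fun j => ?_) j
    · simpa using h2 j
    · simpa using h2' j

theorem triv_single {ι : Type*} [Fintype ι] {f : ι → R} (c : ι → R) (y : M)
    (h : ∑ i, f i * c i = 0) : IsTrivialRelation f (fun i => c i • y) :=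
  ⟨1, fun i _ => c i, fun _ => y, by simp, fun _ => h⟩

theorem triv_cons {l : ℕ} {f : Fin l → R} (a : R) {x : Fin l → M}
    (h : IsTrivialRelation f x) :
    IsTrivialRelation (Fin.cons a f : Fin (l + 1) → R) (Fin.cons 0 x : Fin (l + 1) → M) := by
  obtain ⟨k, c, y, h1, h2⟩ := h
  refine ⟨k, Fin.cons 0 c, y, fun i => ?_, fun j => ?_⟩
  · refine Fin.cases ?_ (fun i => ?_) i
    · simp
    · simpa using h1 i
  · simpa [Fin.sum_univ_succ] using h2 j

theorem flat_of_colon (h : ∀ (J : Ideal R) (a : R) (c : M), a • c ∈ J • (⊤ : Submodule R M) →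
    c ∈ (Submodule.colon J {a} : Ideal R) • (⊤ : Submodule R M)) : Module.Flat R M := by
  apply Module.Flat.of_forall_isTrivialRelation
  intro l
  induction l with
  | zero => intro f x _; exact ⟨0, fun i => i.elim0, fun i => i.elim0, fun i => i.elim0, fun j => j.elim0⟩
  | succ l ih =>
    intro f x hfx
    have key : ∀ c : M, c ∈ (Submodule.colon (Ideal.span (Set.range (Fin.tail f))) {f 0} : Ideal R) •
        (⊤ : Submodule R M) →
        ∃ x' : Fin l → M, IsTrivialRelation f (Fin.cons c x' : Fin (l + 1) → M) := by
      intro c hc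
      refine Submodule.smul_induction_on hc ?_ ?_
      · intro r hr n _
        have hr' := Submodule.mem_colon_singleton.1 hr
        obtain ⟨s, hs⟩ := Ideal.mem_span_range_iff_exists_fun.1 hr'
        refine ⟨fun i => (- s i) • n, ?_⟩
        convert triv_single (f := f) (Fin.cons r (fun i => - s i) : Fin (l + 1) → R) n ?_ using 1
        · ext i
          refine Fin.cases ?_ (fun i => ?_) i <;> simp
        · rw [Fin.sum_univ_succ]
          simp only [Fin.cons_zero, Fin.cons_succ, mul_neg, Finset.sum_neg_distrib]
          rw [mul_comm, ← smul_eq_mul, ← hs, ← sub_eq_add_neg, sub_eq_zero]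
          exact Finset.sum_congr rfl fun i _ => mul_comm _ _
      · rintro u v ⟨x₁, h₁⟩ ⟨x₂, h₂⟩
        refine ⟨x₁ + x₂, ?_⟩
        convert triv_add h₁ h₂ using 1
        ext i
        refine Fin.cases ?_ (fun i => ?_) i <;> simp
    obtain ⟨x', hx'⟩ := key (x 0) (h _ _ _ (by
      rw [Fin.sum_univ_succ] at hfx
      rw [eq_neg_of_add_eq_zero_left hfx]
      refine Submodule.neg_mem _ (Submodule.sum_mem _ fun i _ => ?_)
      exact Submodule.smul_mem_smul (Ideal.subset_span ⟨i, rfl⟩) trivial))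
    have h0 := Module.sum_smul_eq_zero_of_isTrivialRelation hx'
    have h1 := ih (f := Fin.tail f) (x := fun i => x i.succ - x' i) (by
      have : ∑ i, f i • x i - ∑ i, f i • (Fin.cons (x 0) x' : Fin (l + 1) → M) i = 0 := by
        rw [hfx, h0, sub_zero]
      rw [Fin.sum_univ_succ, Fin.sum_univ_succ] at this
      simp only [Fin.cons_zero, Fin.cons_succ, add_sub_add_left_eq_sub] at this
      rw [← this, ← Finset.sum_sub_distrib]
      exact Finset.sum_congr rfl fun i _ => by rw [smul_sub]; rfl)
    have h2 := triv_cons (f 0) h1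
    have e : (Fin.cons (f 0) (Fin.tail f) : Fin (l + 1) → R) = f := Fin.cons_self_tail f
    rw [e] at h2
    convert triv_add hx' h2 using 1
    ext i
    refine Fin.cases ?_ (fun i => ?_) i <;> simp

end

section
variable {R B : Type*} [CommRing R] [CommRing B] [Algebra R B]

theorem mem_map_quot_iff (h : B) (C : Type*) [CommRing C] [Algebra B C]
    [IsLocalization.Away h C] (I A : Ideal B) (b : B) :
    Ideal.Quotient.mk (I.map (algebraMap B C)) (algebraMap B C b) ∈
      A.map ((Ideal.Quotient.mk (I.map (algebraMap B C))).comp (algebraMap B C)) ↔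
      ∃ t ∈ Submonoid.powers h, t * b ∈ A ⊔ I := by
  rw [← Ideal.map_map, Ideal.mem_quotient_iff_mem_sup, ← Ideal.map_sup,
    IsLocalization.algebraMap_mem_map_algebraMap_iff (Submonoid.powers h)]

theorem flat_of_CP (h : B) (C : Type*) [CommRing C] [Algebra B C] [Algebra R C]
    [IsScalarTower R B C] [IsLocalization.Away h C] (I : Ideal B)
    (hC : CP R (Submonoid.powers h) I) : Module.Flat R (C ⧸ I.map (algebraMap B C)) := by
  apply flat_of_colon
  intro J a c hc
  rw [Ideal.smul_top_eq_map, Submodule.restrictScalars_mem] at hc ⊢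
  obtain ⟨c, rfl⟩ := Ideal.Quotient.mk_surjective c
  have hmap : ∀ J : Ideal R, J.map (algebraMap R (C ⧸ I.map (algebraMap B C))) =
      (J.map (algebraMap R B)).map ((Ideal.Quotient.mk (I.map (algebraMap B C))).comp (algebraMap B C)) := by
    intro J
    rw [Ideal.map_map]
    congr 1
    ext r
    simp only [RingHom.comp_apply]
    rw [← IsScalarTower.algebraMap_apply R B C]
    rfl
  obtain ⟨⟨b, s⟩, hbs⟩ := IsLocalization.surj (Submonoid.powers h) c
  simp only at hbs
  have hu := (IsLocalization.map_units C s).map (Ideal.Quotient.mk (I.map (algebraMap B C)))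
  rw [hmap] at hc ⊢
  rw [← Ideal.mul_unit_mem_iff_mem _ hu, ← map_mul, hbs, mem_map_quot_iff h]
  have hc' : Ideal.Quotient.mk (I.map (algebraMap B C)) (algebraMap B C (algebraMap R B a * b)) ∈
      (J.map (algebraMap R B)).map ((Ideal.Quotient.mk (I.map (algebraMap B C))).comp (algebraMap B C)) := by
    rw [map_mul, ← hbs, ← IsScalarTower.algebraMap_apply, ← mul_assoc, map_mul]
    refine Ideal.mul_mem_right _ _ ?_
    convert hc using 1
    rw [map_mul, Algebra.smul_def]; rfl
  obtain ⟨t, ht, h1⟩ := (mem_map_quot_iff h C _ _ _).1 hc'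
  obtain ⟨t', ht', h2⟩ := hC J a (t * b) (by convert h1 using 1; ring)
  exact ⟨t' * t, Submonoid.mul_mem _ ht' ht, by convert h2 using 1; ring⟩

theorem reg_of_Gd (h : B) (C : Type*) [CommRing C] [Algebra B C]
    [IsLocalization.Away h C] (I : Ideal B) (f : B)
    (hf : Gd R (Submonoid.powers h) I f ⊥) (c : C)
    (hc : algebraMap B C f * c ∈ I.map (algebraMap B C)) : c ∈ I.map (algebraMap B C) := by
  obtain ⟨⟨b, s⟩, hbs⟩ := IsLocalization.surj (Submonoid.powers h) c
  simp only at hbs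
  have hu := (IsLocalization.map_units C s)
  rw [← Ideal.mul_unit_mem_iff_mem _ hu, hbs,
    IsLocalization.algebraMap_mem_map_algebraMap_iff (Submonoid.powers h)]
  have h1 : algebraMap B C (f * b) ∈ I.map (algebraMap B C) := by
    rw [map_mul, ← hbs, ← mul_assoc]
    exact Ideal.mul_mem_right _ _ hc
  obtain ⟨t, ht, h2⟩ := (IsLocalization.algebraMap_mem_map_algebraMap_iff (Submonoid.powers h) C _ _).1 h1
  obtain ⟨t', ht', h3⟩ := hf (t * b) (Ideal.mem_sup_right (by convert h2 using 1; ring))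
  rw [Ideal.map_bot, bot_sup_eq] at h3
  exact ⟨t' * t, Submonoid.mul_mem _ ht' ht, by convert h3 using 1; ring⟩

theorem wr_iff {C : Type*} [CommRing C] (fs : List C) :
    RingTheory.Sequence.IsWeaklyRegular C fs ↔ ∀ (l₁ : List C) (f : C) (l₂ : List C),
      fs = l₁ ++ f :: l₂ → ∀ c, f * c ∈ Ideal.ofList l₁ → c ∈ Ideal.ofList l₁ := by
  rw [RingTheory.Sequence.isWeaklyRegular_iff]
  constructor
  · rintro H l₁ f l₂ rfl c hc
    have := H l₁.length (by simp)
    simp only [List.take_left, List.getElem_append_right (le_refl _), Nat.sub_self,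
      List.getElem_cons_zero, isSMulRegular_quotient_iff_mem_of_smul_mem, smul_eq_mul,
      Ideal.mul_top] at this
    exact this c hc
  · intro H i hi
    rw [isSMulRegular_quotient_iff_mem_of_smul_mem]
    intro x hx
    simp only [smul_eq_mul, Ideal.mul_top] at hx ⊢
    refine H (fs.take i) fs[i] (fs.drop (i + 1)) ?_ x hx
    rw [← List.drop_eq_getElem_cons hi, List.take_append_drop]

open TensorProduct in
/-- universal regularity -/
theorem reg_tensor {C : Type*} [CommRing C] [Algebra R C] (I : Ideal C) (f : C)
    (hreg : ∀ c, f * c ∈ I → c ∈ I) [Module.Flat R (C ⧸ I ⊔ Ideal.span {f})]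
    (H : Type*) [CommRing H] [Algebra R H] (g : H ⊗[R] C)
    (hg : (1 ⊗ₜ f) * g ∈ I.map (Algebra.TensorProduct.includeRight : C →ₐ[R] H ⊗[R] C)) :
    g ∈ I.map (Algebra.TensorProduct.includeRight : C →ₐ[R] H ⊗[R] C) := by
  let mu : (C ⧸ I) →ₗ[R] (C ⧸ I) := LinearMap.mulLeft R (Ideal.Quotient.mk I f)
  let pr : (C ⧸ I) →ₗ[R] (C ⧸ I ⊔ Ideal.span {f}) :=
    (Ideal.Quotient.factorₐ R (le_sup_left : I ≤ I ⊔ Ideal.span {f})).toLinearMap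
  have hmu : Function.Injective mu := by
    rw [injective_iff_map_eq_zero]
    intro c hc
    obtain ⟨c, rfl⟩ := Ideal.Quotient.mk_surjective c
    have : Ideal.Quotient.mk I (f * c) = 0 := by rw [map_mul]; exact hc
    rw [Ideal.Quotient.eq_zero_iff_mem] at this ⊢
    exact hreg c this
  have hpr : Function.Surjective pr := Ideal.Quotient.factor_surjective (le_sup_left : I ≤ I ⊔ Ideal.span {f})
  have hex : Function.Exact mu pr := by
    intro c
    obtain ⟨c, rfl⟩ := Ideal.Quotient.mk_surjective c
    have e : pr (Ideal.Quotient.mk I c) = Ideal.Quotient.mk (I ⊔ Ideal.span {f}) c := rfl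
    rw [e, Ideal.Quotient.eq_zero_iff_mem]
    constructor
    · intro hc
      obtain ⟨i, hi, j, hj, rfl⟩ := Submodule.mem_sup.1 hc
      obtain ⟨d, rfl⟩ := Ideal.mem_span_singleton.1 hj
      refine ⟨Ideal.Quotient.mk I d, ?_⟩
      change Ideal.Quotient.mk I f * Ideal.Quotient.mk I d = _
      rw [map_add, Ideal.Quotient.eq_zero_iff_mem.2 hi, zero_add, map_mul]
    · rintro ⟨d, hd⟩
      obtain ⟨d, rfl⟩ := Ideal.Quotient.mk_surjective d
      have hd' : Ideal.Quotient.mk I (f * d) = Ideal.Quotient.mk I c := by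
        rw [map_mul]; exact hd
      rw [Ideal.Quotient.eq] at hd'
      have : c = -(f * d - c) + f * d := by ring
      rw [this]
      exact Submodule.add_mem_sup (neg_mem hd')
        (Ideal.mul_mem_right _ _ (Ideal.mem_span_singleton_self f))
  have inj := LinearMap.lTensor_injective_of_exact_of_flat pr hpr mu hmu hex H
  let π : H ⊗[R] C →ₐ[R] H ⊗[R] (C ⧸ I) :=
    Algebra.TensorProduct.map (AlgHom.id R H) (Ideal.Quotient.mkₐ R I)
  have hker : RingHom.ker π = I.map (Algebra.TensorProduct.includeRight : C →ₐ[R] H ⊗[R] C) := by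
    have := Algebra.TensorProduct.lTensor_ker (A := H) (Ideal.Quotient.mkₐ R I)
      (Ideal.Quotient.mkₐ_surjective R I)
    have e : RingHom.ker (Ideal.Quotient.mkₐ R I) = I := Ideal.Quotient.mkₐ_ker R I
    rw [e] at this
    exact this
  rw [← hker, RingHom.mem_ker] at hg ⊢
  apply inj
  rw [map_zero, ← hg, map_mul]
  have : ∀ z : H ⊗[R] (C ⧸ I), mu.lTensor H z = ((1 : H) ⊗ₜ[R] (Ideal.Quotient.mk I f)) * z := by
    intro z
    induction z with
    | zero => simp
    | tmul a b => simp [mu]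
    | add a b ha hb => rw [map_add, ha, hb, mul_add]
  rw [this]
  congr 1
end
end

section
theorem isNoetherian_quot (O : Type*) [CommRing O] (P : Ideal O) [IsNoetherianRing (O ⧸ P)] :
    IsNoetherian O (O ⧸ P) := by
  refine ⟨fun N => ?_⟩
  have hc : ∀ (c : O ⧸ P) {x : O ⧸ P}, x ∈ N → c * x ∈ N := by
    intro c x hx
    obtain ⟨c, rfl⟩ := Ideal.Quotient.mk_surjective c
    exact N.smul_mem c hx
  let N' : Ideal (O ⧸ P) := { carrier := N, add_mem' := N.add_mem, zero_mem' := N.zero_mem,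
                              smul_mem' := fun c x hx => hc c hx }
  obtain ⟨S, hS⟩ := (IsNoetherian.noetherian N')
  refine ⟨S, le_antisymm ?_ ?_⟩
  · rw [Submodule.span_le]
    intro x hx
    have : x ∈ N' := hS ▸ Submodule.subset_span hx
    exact this
  · intro x hx
    have : x ∈ Submodule.span (O ⧸ P) (S : Set (O ⧸ P)) := hS ▸ hx
    refine Submodule.span_induction ?_ ?_ ?_ ?_ this
    · intro x hx; exact Submodule.subset_span hx
    · exact Submodule.zero_mem _
    · intro x y _ _ h1 h2; exact Submodule.add_mem _ h1 h2
    · intro a x _ h1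
      obtain ⟨a, rfl⟩ := Ideal.Quotient.mk_surjective a
      exact Submodule.smul_mem _ a h1

theorem fg_mod {O : Type*} [CommRing O] (P : Ideal O) [IsNoetherianRing (O ⧸ P)]
    (I N : Ideal O) (hI : I.FG) (hN : N ≤ I) :
    ∃ N0 : Ideal O, N0.FG ∧ N0 ≤ N ∧ N ≤ N0 ⊔ P * I := by
  have := isNoetherian_quot O P
  obtain ⟨n, s, hs⟩ := Submodule.fg_iff_exists_fin_generating_family.1 hI
  have hsI : ∀ i, s i ∈ I := fun i => hs ▸ Submodule.subset_span ⟨i, rfl⟩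
  let σ : (Fin n → O) →ₗ[O] O := Fintype.linearCombination O s
  have hσ : ∀ c, σ c = ∑ i, c i * s i := fun c => by simp [σ, Fintype.linearCombination_apply]
  let π : (Fin n → O) →ₗ[O] (Fin n → O ⧸ P) := LinearMap.pi fun i =>
    (Ideal.Quotient.mkₐ O P).toLinearMap ∘ₗ LinearMap.proj i
  have hπ : ∀ c i, π c i = Ideal.Quotient.mk P (c i) := fun c i => rfl
  have hfg : (Submodule.map π (Submodule.comap σ N)).FG := IsNoetherian.noetherian _
  obtain ⟨k, t, ht⟩ := Submodule.fg_iff_exists_fin_generating_family.1 hfg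
  have hlift : ∀ j, ∃ c, σ c ∈ N ∧ π c = t j := by
    intro j
    have : t j ∈ Submodule.map π (Submodule.comap σ N) := ht ▸ Submodule.subset_span ⟨j, rfl⟩
    obtain ⟨c, hc, h⟩ := this
    exact ⟨c, hc, h⟩
  choose c hcN hct using hlift
  refine ⟨Ideal.span (Set.range fun j => σ (c j)), ⟨(Set.finite_range fun j => σ (c j)).toFinset, by simp⟩, ?_, ?_⟩
  · rw [Ideal.span_le]; rintro _ ⟨j, rfl⟩; exact hcN j
  · intro x hx
    have hxI : x ∈ Ideal.span (Set.range s) := by rw [Ideal.span, hs]; exact hN hx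
    obtain ⟨d, hd⟩ := Ideal.mem_span_range_iff_exists_fun.1 hxI
    rw [← hσ] at hd
    have h1 : π d ∈ Submodule.span O (Set.range t) := by
      rw [ht]; exact ⟨d, by simpa [hd] using hx, rfl⟩
    obtain ⟨a, ha⟩ := (Submodule.mem_span_range_iff_exists_fun O).1 h1
    have h2 : π (d - ∑ j, a j • c j) = 0 := by
      rw [map_sub, map_sum, ← ha, sub_eq_zero]
      exact Finset.sum_congr rfl fun j _ => by rw [map_smul, hct]
    have h3 : x = σ (∑ j, a j • c j) + σ (d - ∑ j, a j • c j) := by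
      rw [← map_add, ← hd]; congr 1; abel
    rw [h3]
    refine Submodule.add_mem_sup ?_ ?_
    · rw [map_sum]
      refine Submodule.sum_mem _ fun j _ => ?_
      rw [map_smul]
      exact Submodule.smul_mem _ _ (Ideal.subset_span ⟨j, rfl⟩)
    · rw [hσ]
      refine Submodule.sum_mem _ fun i _ => Ideal.mul_mem_mul ?_ (hsI i)
      rw [← Ideal.Quotient.eq_zero_iff_mem, ← hπ, h2]; rfl

/-- stepwise regularity modulo `P`. -/
theorem fibre_reg {O : Type*} [CommRing O] (P : Ideal O) [IsNoetherianRing (O ⧸ P)] (l : List O) :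
    (∀ f ∈ l, f ∈ Ideal.jacobson (⊥ : Ideal O)) →
    (∀ (l₁ : List O) (f : O) (l₂ : List O), l = l₁ ++ f :: l₂ →
      ∀ c, f * c ∈ Ideal.ofList l₁ → c ∈ Ideal.ofList l₁) →
    (∀ x ∈ Ideal.ofList l, x ∈ P → x ∈ P * Ideal.ofList l) →
    ∀ (l₁ : List O) (f : O) (l₂ : List O), l = l₁ ++ f :: l₂ →
      ∀ c, f * c ∈ Ideal.ofList l₁ ⊔ P → c ∈ Ideal.ofList l₁ ⊔ P := by
  induction l using List.reverseRecOn with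
  | nil => intro _ _ _ l₁ f l₂ h; simp at h
  | append_singleton l g ih =>
    intro hJ hreg hD
    have hregg := hreg l g [] rfl
    set I := Ideal.ofList l with hI
    have hIg : Ideal.ofList (l ++ [g]) = I ⊔ Ideal.span {g} := by
      rw [Ideal.ofList_append, Ideal.ofList_singleton]
    rw [hIg] at hD
    -- decomposition
    have hdec : ∀ x ∈ P, ∀ i ∈ I, ∀ c, x = i + g * c → ∃ a ∈ P * I, ∃ z ∈ P, x = a + g * z := by
      intro x hx i hi c hxc
      have h1 := hD x (hxc ▸ Submodule.add_mem_sup hi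
        (Ideal.mul_mem_right _ _ (Ideal.mem_span_singleton_self g))) hx
      rw [Ideal.mul_sup] at h1
      obtain ⟨a, ha, y, hy, hay⟩ := Submodule.mem_sup.1 h1
      obtain ⟨z, hz, hzy⟩ := Ideal.mem_mul_span_singleton.1 hy
      exact ⟨a, ha, z, hz, by rw [← hay, ← hzy, mul_comm z g]⟩
    have hPI : ∀ a ∈ P * I, a ∈ P ∧ a ∈ I := fun a ha => mem_and_of_mem_mul ha
    have hfgI : I.FG := by
      rw [hI]; exact ⟨(l.finite_toSet).toFinset, by simp⟩
    have hD' : ∀ x ∈ I, x ∈ P → x ∈ P * I := by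
      obtain ⟨N0, hfg, hle, hge⟩ := fg_mod P I (I ⊓ P) hfgI inf_le_left
      have hNak : N0 ≤ P * I := by
        refine Submodule.le_of_le_smul_of_le_jacobson_bot (I := Ideal.span {g}) hfg ?_ ?_
        · rw [Ideal.span_le, Set.singleton_subset_iff]; exact hJ g (by simp)
        · intro x hx
          obtain ⟨hxI, hxP⟩ := hle hx
          obtain ⟨a, ha, z, hz, e⟩ := hdec x hxP x hxI 0 (by ring)
          have hzI : z ∈ I := hregg z (by
            have : g * z = x - a := by rw [e]; ring
            rw [this]; exact sub_mem hxI (hPI a ha).2)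
          obtain ⟨n, hn, b, hb, e2⟩ := Submodule.mem_sup.1 (hge ⟨hzI, hz⟩)
          have : x = (a + g * b) + g * n := by rw [e, ← e2]; ring
          rw [this]
          refine Submodule.add_mem_sup (add_mem ha (Ideal.mul_mem_left _ _ hb)) ?_
          exact Ideal.mul_mem_mul (Ideal.mem_span_singleton_self g) hn
      intro x hx hxP
      have h2 := hge ⟨hx, hxP⟩
      rwa [sup_eq_right.2 hNak] at h2
    have ih' := ih (fun f hf => hJ f (by simp [hf]))
      (fun l₁ f l₂ h => hreg l₁ f (l₂ ++ [g]) (by simp [h])) hD'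
    intro l₁ f l₂ h c hc
    rcases List.eq_nil_or_concat' l₂ with rfl | ⟨l₂, g', rfl⟩
    · obtain ⟨rfl, hh⟩ := List.append_inj' h rfl
      obtain rfl : g = f := by simpa using hh
      obtain ⟨i, hi, y, hy, e⟩ := Submodule.mem_sup.1 hc
      obtain ⟨a, ha, z, hz, e2⟩ := hdec y hy (-i) (neg_mem hi) c (by rw [← e]; ring)
      have h3 : c - z ∈ I := hregg _ (by
        have : g * (c - z) = i + a := by
          rw [mul_sub, ← e, e2]; ring
        rw [this]; exact add_mem hi (hPI a ha).2)
      have : c = (c - z) + z := by ring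
      rw [this]; exact Submodule.add_mem_sup h3 hz
    · have h' : l ++ [g] = (l₁ ++ f :: l₂) ++ [g'] := by simpa using h
      obtain ⟨h1, _⟩ := List.append_inj' h' rfl
      exact ih' l₁ f l₂ h1 c hc
end

section
theorem noeth_of_unit {A S : Type*} [CommRing A] [CommRing S] [IsNoetherianRing A] (φ : A →+* S)
    (h : ∀ s : S, ∃ a : A, ∃ u : S, IsUnit u ∧ s * u = φ a) : IsNoetherianRing S := by
  refine ⟨fun J => ?_⟩
  have : J = Ideal.map φ (Ideal.comap φ J) := by
    refine le_antisymm (fun s hs => ?_) Ideal.map_comap_le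
    obtain ⟨a, u, hu, e⟩ := h s
    rw [← Ideal.mul_unit_mem_iff_mem _ hu, e]
    exact Ideal.mem_map_of_mem _ (by rw [Ideal.mem_comap, ← e]; exact Ideal.mul_mem_right _ _ hs)
  rw [this]
  exact Ideal.FG.map (IsNoetherian.noetherian (Ideal.comap φ J)) φ

theorem noeth_fibre {V : Type*} [CommRing V] {m : ℕ} (q : Ideal (MvPolynomial (Fin m) V))
    [q.IsPrime] (O : Type*) [CommRing O] [Algebra (MvPolynomial (Fin m) V) O]
    [IsLocalization.AtPrime O q] :
    IsNoetherianRing (O ⧸ ((q.comap (MvPolynomial.C)).map MvPolynomial.C).map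
      (algebraMap (MvPolynomial (Fin m) V) O)) := by
  set p := q.comap (MvPolynomial.C : V →+* _) with hp
  have : p.IsPrime := Ideal.comap_isPrime _ _
  set P := (p.map MvPolynomial.C).map (algebraMap (MvPolynomial (Fin m) V) O)
  let β : MvPolynomial (Fin m) V →+* O ⧸ P := (Ideal.Quotient.mk P).comp (algebraMap _ O)
  let g : V ⧸ p →+* O ⧸ P := Ideal.Quotient.lift p (β.comp MvPolynomial.C) (by
    intro a ha
    exact Ideal.Quotient.eq_zero_iff_mem.2 (Ideal.mem_map_of_mem _ (Ideal.mem_map_of_mem _ ha)))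
  have hβ : ∀ b : MvPolynomial (Fin m) V, b ∉ q → IsUnit (β b) := fun b hb =>
    (IsLocalization.map_units O (⟨b, hb⟩ : q.primeCompl)).map (Ideal.Quotient.mk P)
  have hg : ∀ y : nonZeroDivisors (V ⧸ p), IsUnit (g y) := by
    rintro ⟨y, hy⟩
    obtain ⟨y, rfl⟩ := Ideal.Quotient.mk_surjective y
    refine hβ (MvPolynomial.C y) fun h => ?_
    exact nonZeroDivisors.ne_zero hy (Ideal.Quotient.eq_zero_iff_mem.2 h)
  let gK : FractionRing (V ⧸ p) →+* O ⧸ P := IsLocalization.lift hg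
  have hgK : ∀ v : V, gK (algebraMap _ _ (Ideal.Quotient.mk p v)) = β (MvPolynomial.C v) := fun v => by
    rw [IsLocalization.lift_eq]; rfl
  let φ : MvPolynomial (Fin m) (FractionRing (V ⧸ p)) →+* O ⧸ P :=
    MvPolynomial.eval₂Hom gK (fun i => β (MvPolynomial.X i))
  refine noeth_of_unit φ fun s => ?_
  obtain ⟨s, rfl⟩ := Ideal.Quotient.mk_surjective s
  obtain ⟨⟨b, t⟩, hbt⟩ := IsLocalization.surj q.primeCompl s
  refine ⟨MvPolynomial.map ((algebraMap _ _).comp (Ideal.Quotient.mk p)) b, β t, hβ _ t.2, ?_⟩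
  have h1 : φ.comp (MvPolynomial.map ((algebraMap _ (FractionRing (V ⧸ p))).comp (Ideal.Quotient.mk p))) = β := by
    refine MvPolynomial.ringHom_ext (fun r => ?_) (fun i => ?_)
    · simp only [RingHom.comp_apply, MvPolynomial.map_C, φ, MvPolynomial.eval₂Hom_C]
      exact hgK r
    · simp [φ]
  have h2 := congrArg (fun F => F b) h1
  simp only [RingHom.comp_apply] at h2
  rw [h2]
  have h3 := congrArg (Ideal.Quotient.mk P) hbt
  rw [map_mul] at h3
  exact h3

theorem mem_map_C_val {V : Type*} [CommRing V] [IsDomain V] [ValuationRing V] {m : ℕ} (p : Ideal V)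
    (b : MvPolynomial (Fin m) V) (hb : b ∈ p.map (MvPolynomial.C : V →+* MvPolynomial (Fin m) V)) :
    ∃ t ∈ p, ∃ g, b = MvPolynomial.C t * g := by
  refine Submodule.span_induction ?_ ?_ ?_ ?_ hb
  · rintro _ ⟨t, ht, rfl⟩; exact ⟨t, ht, 1, by simp⟩
  · exact ⟨0, p.zero_mem, 0, by simp⟩
  · rintro _ _ _ _ ⟨t, ht, g, rfl⟩ ⟨t', ht', g', rfl⟩
    rcases ValuationRing.dvd_total t t' with ⟨c, rfl⟩ | ⟨c, rfl⟩
    · exact ⟨t, ht, g + MvPolynomial.C c * g', by rw [MvPolynomial.C_mul]; ring⟩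
    · exact ⟨t', ht', g' + MvPolynomial.C c * g, by rw [MvPolynomial.C_mul]; ring⟩
  · rintro a _ _ ⟨t, ht, g, rfl⟩
    exact ⟨t, ht, a * g, by rw [smul_eq_mul]; ring⟩

theorem fibre_Gd {V : Type*} [CommRing V] [IsDomain V] [ValuationRing V] {m : ℕ}
    (q : Ideal (MvPolynomial (Fin m) V)) [q.IsPrime] (F : List (MvPolynomial (Fin m) V))
    (hF : ∀ f ∈ F, f ∈ q)
    (hreg : ∀ l₁ f l₂, F = l₁ ++ f :: l₂ →
      ∀ c, f * c ∈ Ideal.ofList l₁ → c ∈ Ideal.ofList l₁)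
    (htf : ∀ t : V, t ≠ 0 → ∀ g, MvPolynomial.C t * g ∈ Ideal.ofList F → g ∈ Ideal.ofList F) :
    ∀ l₁ f l₂, F = l₁ ++ f :: l₂ →
      Gd V q.primeCompl (Ideal.ofList l₁) f (q.comap (algebraMap V _)) := by
  intro l₁ f l₂ hl b hb
  let B := MvPolynomial (Fin m) V
  let O := Localization.AtPrime q
  let α := algebraMap B O
  have := noeth_fibre q O
  set p := q.comap (MvPolynomial.C : V →+* _) with hp
  set P := (p.map (MvPolynomial.C : V →+* B)).map α with hP
  have key := fibre_reg P (F.map α) ?_ ?_ ?_ (l₁.map α) (α f) (l₂.map α) (by simp [hl]) (α b) ?_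
  · rw [← Ideal.map_ofList, hP, ← Ideal.map_sup, sup_comm] at key
    exact (IsLocalization.algebraMap_mem_map_algebraMap_iff q.primeCompl O _ b).1 key
  · intro g hg
    obtain ⟨g, hg', rfl⟩ := List.mem_map.1 hg
    rw [IsLocalRing.jacobson_eq_maximalIdeal _ bot_ne_top, IsLocalization.AtPrime.to_map_mem_maximal_iff O q]
    exact hF g hg'
  · intro k₁ g k₂ hk c hc
    obtain ⟨u₁, u₂, hFu, rfl, hu'⟩ := List.map_eq_append_iff.1 hk
    obtain ⟨g, u₂, rfl, rfl, rfl⟩ := List.map_eq_cons_iff.1 hu'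
    rw [← Ideal.map_ofList] at hc ⊢
    obtain ⟨⟨b, s⟩, hbs⟩ := IsLocalization.surj q.primeCompl c
    simp only at hbs
    have hu := (IsLocalization.map_units O s)
    rw [← Ideal.mul_unit_mem_iff_mem _ hu, hbs,
      IsLocalization.algebraMap_mem_map_algebraMap_iff q.primeCompl]
    have h1 : algebraMap B O (g * b) ∈ (Ideal.ofList u₁).map (algebraMap B O) := by
      rw [map_mul, ← hbs, ← mul_assoc]
      exact Ideal.mul_mem_right _ _ hc
    obtain ⟨t, ht, h2⟩ := (IsLocalization.algebraMap_mem_map_algebraMap_iff q.primeCompl O _ _).1 h1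
    exact ⟨t, ht, hreg u₁ g u₂ hFu _ (by convert h2 using 1; ring)⟩
  · intro x hx hxP
    rw [← Ideal.map_ofList] at hx ⊢
    obtain ⟨⟨b, s⟩, hbs⟩ := IsLocalization.surj q.primeCompl x
    simp only at hbs
    have h1 : algebraMap B O b ∈ P := hbs ▸ Ideal.mul_mem_right _ _ hxP
    have h2 : algebraMap B O b ∈ (Ideal.ofList F).map α := hbs ▸ Ideal.mul_mem_right _ _ hx
    obtain ⟨s1, hs1, h1⟩ := (IsLocalization.algebraMap_mem_map_algebraMap_iff q.primeCompl O _ _).1 h1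
    obtain ⟨s2, hs2, h2⟩ := (IsLocalization.algebraMap_mem_map_algebraMap_iff q.primeCompl O _ _).1 h2
    obtain ⟨t, ht, g, hg⟩ := mem_map_C_val p _ h1
    have h3 : α (s2 * (s1 * b)) ∈ P * (Ideal.ofList F).map α := by
      rw [hP, ← Ideal.map_mul]
      refine Ideal.mem_map_of_mem _ ?_
      by_cases h0 : t = 0
      · rw [hg, h0]; simp
      · have h4 : s2 * g ∈ Ideal.ofList F := htf t h0 _ (by
          have : MvPolynomial.C t * (s2 * g) = s1 * (s2 * b) := by
            linear_combination (- s2) * hg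
          rw [this]; exact Ideal.mul_mem_left _ _ h2)
        have : s2 * (s1 * b) = MvPolynomial.C t * (s2 * g) := by rw [hg]; ring
        rw [this]
        exact Ideal.mul_mem_mul (Ideal.mem_map_of_mem _ ht) h4
    have hu := (IsLocalization.map_units O s)
    have hu1 := (IsLocalization.map_units O (⟨s1, hs1⟩ : q.primeCompl))
    have hu2 := (IsLocalization.map_units O (⟨s2, hs2⟩ : q.primeCompl))
    rw [← Ideal.mul_unit_mem_iff_mem _ hu, hbs, ← Ideal.mul_unit_mem_iff_mem _ hu1,
      ← Ideal.mul_unit_mem_iff_mem _ hu2]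
    convert h3 using 1
    simp only [map_mul]; ring
  · rw [← map_mul, ← Ideal.map_ofList, hP, ← Ideal.map_sup, sup_comm]
    exact Ideal.mem_map_of_mem _ hb
end

section
theorem mem_ofList_iff {A : Type*} [CommRing A] (l : List A) (x : A) :
    x ∈ Ideal.ofList l ↔ ∃ c : Fin l.length → A, ∑ i, c i * l.get i = x := by
  rw [← Ideal.mem_span_range_iff_exists_fun, Set.range_list_get]

theorem colon_flat {A S : Type*} [CommRing A] [CommRing S] [Algebra A S] [Module.Flat A S]
    (l : List A) (b : A) (T : S) (Q : Ideal S) (hT : T ∉ Q)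
    (h : T * algebraMap A S b ∈ (Ideal.ofList l).map (algebraMap A S)) :
    ∃ t : A, algebraMap A S t ∉ Q ∧ t * b ∈ Ideal.ofList l := by
  have hl : (Ideal.ofList l).map (algebraMap A S) =
      Ideal.span (Set.range fun i => algebraMap A S (l.get i)) := by
    have : Ideal.ofList l = Ideal.span (Set.range l.get) := by rw [Set.range_list_get]
    rw [this, Ideal.map_span, ← Set.range_comp]; rfl
  rw [hl] at h
  obtain ⟨u, hu⟩ := Ideal.mem_span_range_iff_exists_fun.1 h
  have hrel : ∑ i, (Fin.cons b l.get : Fin (l.length + 1) → A) i •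
      (Fin.cons T (fun i => - u i) : Fin (l.length + 1) → S) i = 0 := by
    rw [Fin.sum_univ_succ]
    simp only [Fin.cons_zero, Fin.cons_succ, Algebra.smul_def, mul_neg, Finset.sum_neg_distrib]
    rw [mul_comm, ← hu, ← sub_eq_add_neg, sub_eq_zero]
    exact Finset.sum_congr rfl fun i _ => mul_comm _ _
  obtain ⟨k, a, y, h1, h2⟩ := Module.Flat.isTrivialRelation_of_sum_smul_eq_zero (R := A) (M := S) hrel
  have hT' : T = ∑ j, a 0 j • y j := h1 0
  obtain ⟨j, hj⟩ : ∃ j, algebraMap A S (a 0 j) ∉ Q := by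
    by_contra hcon
    push Not at hcon
    apply hT
    rw [hT']
    refine Submodule.sum_mem _ fun j _ => ?_
    rw [Algebra.smul_def]
    exact Ideal.mul_mem_right _ _ (hcon j)
  refine ⟨a 0 j, hj, (mem_ofList_iff _ _).2 ⟨fun i => - a i.succ j, ?_⟩⟩
  have h3 := h2 j
  rw [Fin.sum_univ_succ] at h3
  simp only [Fin.cons_zero, Fin.cons_succ] at h3
  simp only [neg_mul, Finset.sum_neg_distrib]
  rw [mul_comm (a 0 j), eq_neg_of_add_eq_zero_left h3]
  congr 1
  exact Finset.sum_congr rfl fun i _ => mul_comm _ _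

theorem flat_of_inj_field (A k : Type*) [CommRing A] [IsDomain A] [Field k] [Algebra A k]
    (h : Function.Injective (algebraMap A k)) : Module.Flat A k := by
  have : FaithfulSMul A k := (faithfulSMul_iff_algebraMap_injective A k).2 h
  letI := FractionRing.liftAlgebra A k
  have := FractionRing.isScalarTower_liftAlgebra A k
  have : Module.Flat A (FractionRing A) := IsLocalization.flat _ (nonZeroDivisors A)
  exact Module.Flat.trans A (FractionRing A) k

open MvPolynomial in
theorem flat_poly (A k σ : Type*) [CommRing A] [CommRing k] [Algebra A k] [Module.Flat A k] :
    letI := MvPolynomial.algebraMvPolynomial (σ := σ) (R := A) (S := k)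
    Module.Flat (MvPolynomial σ A) (MvPolynomial σ k) := by
  letI := MvPolynomial.algebraMvPolynomial (σ := σ) (R := A) (S := k)
  have : Algebra.IsPushout A (MvPolynomial σ A) k (MvPolynomial σ k) := inferInstance
  exact Module.Flat.isBaseChange A (MvPolynomial σ A) k (MvPolynomial σ k) this.out

open MvPolynomial in
theorem descent {R V k : Type*} [CommRing R] [CommRing V] [Field k] (ρ : R →+* V) (ε : V →+* k)
    {m : ℕ} (x : Fin m → k) (q : Ideal (MvPolynomial (Fin m) V)) (q0 : Ideal (MvPolynomial (Fin m) R))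
    [q.IsPrime] [q0.IsPrime]
    (hq : q = RingHom.ker (eval₂Hom ε x)) (hq0 : q0 = RingHom.ker (eval₂Hom (ε.comp ρ) x))
    (l : List (MvPolynomial (Fin m) R)) (f : MvPolynomial (Fin m) R)
    (h : Gd V q.primeCompl (Ideal.ofList (l.map (MvPolynomial.map ρ))) (MvPolynomial.map ρ f)
      (q.comap (algebraMap V _))) :
    Gd R q0.primeCompl (Ideal.ofList l) f (q0.comap (algebraMap R _)) := by
  intro b hb
  set p := q.comap (algebraMap V (MvPolynomial (Fin m) V)) with hp
  set p0 := q0.comap (algebraMap R (MvPolynomial (Fin m) R)) with hp0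
  have hpk : p = RingHom.ker ε := by
    ext v; simp [hp, hq, RingHom.mem_ker, MvPolynomial.algebraMap_eq]
  have hpk0 : p0 = RingHom.ker (ε.comp ρ) := by
    ext v; simp [hp0, hq0, RingHom.mem_ker, MvPolynomial.algebraMap_eq]
  have : p0.IsPrime := Ideal.comap_isPrime _ _
  -- go up to V
  have hle : p0.map ρ ≤ p := by
    rw [Ideal.map_le_iff_le_comap, hpk0, hpk]; intro v hv; exact hv
  have hmap : (p0.map (algebraMap R (MvPolynomial (Fin m) R))).map (MvPolynomial.map ρ) ≤
      p.map (algebraMap V (MvPolynomial (Fin m) V)) := by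
    have e : (MvPolynomial.map ρ).comp (algebraMap R (MvPolynomial (Fin m) R)) =
        (algebraMap V (MvPolynomial (Fin m) V)).comp ρ := by
      ext v; simp [MvPolynomial.algebraMap_eq]
    rw [Ideal.map_map, e, ← Ideal.map_map]
    exact Ideal.map_mono hle
  have hb' : MvPolynomial.map ρ f * MvPolynomial.map ρ b ∈
      p.map (algebraMap V (MvPolynomial (Fin m) V)) ⊔ Ideal.ofList (l.map (MvPolynomial.map ρ)) := by
    have h1 := Ideal.mem_map_of_mem (MvPolynomial.map ρ) hb
    rw [Ideal.map_sup, Ideal.map_ofList, map_mul] at h1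
    exact (sup_le_sup_right hmap _) h1
  obtain ⟨t, ht, htb⟩ := h _ hb'
  -- go to k
  have htb' : MvPolynomial.map ε t * MvPolynomial.map (ε.comp ρ) b ∈
      Ideal.ofList (l.map (MvPolynomial.map (ε.comp ρ))) := by
    have h1 := Ideal.mem_map_of_mem (MvPolynomial.map ε) htb
    have e : (p.map (algebraMap V (MvPolynomial (Fin m) V))).map (MvPolynomial.map (σ := Fin m) ε) = ⊥ := by
      rw [Ideal.map_map, Ideal.map_eq_bot_iff_le_ker]
      intro v hv
      rw [hpk, RingHom.mem_ker] at hv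
      rw [RingHom.mem_ker, RingHom.comp_apply, MvPolynomial.algebraMap_eq, MvPolynomial.map_C, hv,
        map_zero]
    rw [Ideal.map_sup, Ideal.map_ofList, map_mul, e, bot_sup_eq, List.map_map, MvPolynomial.map_map] at h1
    convert h1 using 3
    ext1 g
    simp [MvPolynomial.map_map]
  -- descend to A = R / p0
  let A := R ⧸ p0
  letI : Algebra A k := (Ideal.Quotient.lift p0 (ε.comp ρ) (fun a ha => by rwa [hpk0] at ha)).toAlgebra
  have hAk : ∀ r : R, algebraMap A k (Ideal.Quotient.mk p0 r) = ε (ρ r) := fun r => rfl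
  have hAinj : Function.Injective (algebraMap A k) := by
    rw [injective_iff_map_eq_zero]
    intro a ha
    obtain ⟨a, rfl⟩ := Ideal.Quotient.mk_surjective a
    rw [hAk] at ha
    rw [Ideal.Quotient.eq_zero_iff_mem, hpk0]; exact ha
  have := flat_of_inj_field A k hAinj
  letI := MvPolynomial.algebraMvPolynomial (σ := Fin m) (R := A) (S := k)
  have : Module.Flat (MvPolynomial (Fin m) A) (MvPolynomial (Fin m) k) := flat_poly A k (Fin m)
  have hal : ∀ g : MvPolynomial (Fin m) R, algebraMap (MvPolynomial (Fin m) A) (MvPolynomial (Fin m) k)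
      (MvPolynomial.map (Ideal.Quotient.mk p0) g) = MvPolynomial.map (ε.comp ρ) g := by
    intro g
    rw [MvPolynomial.algebraMap_def, MvPolynomial.map_map]
    rfl
  have hlist : (l.map (MvPolynomial.map (Ideal.Quotient.mk p0))).map
      (algebraMap (MvPolynomial (Fin m) A) (MvPolynomial (Fin m) k)) =
      l.map (MvPolynomial.map (ε.comp ρ)) := by
    rw [List.map_map]
    exact List.map_congr_left fun g _ => hal g
  have h2 := colon_flat (l.map (MvPolynomial.map (Ideal.Quotient.mk p0)))
    (MvPolynomial.map (Ideal.Quotient.mk p0) b) (MvPolynomial.map ε t)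
    (RingHom.ker (eval₂Hom (RingHom.id k) x)) (by
      intro hcon
      apply ht
      rw [hq]
      rw [RingHom.mem_ker, coe_eval₂Hom, MvPolynomial.eval₂_map] at hcon
      exact hcon) (by
      rw [hal, Ideal.map_ofList, hlist]
      exact htb')
  obtain ⟨τ, hτ, hτb⟩ := h2
  obtain ⟨s, rfl⟩ := MvPolynomial.map_surjective _ (Ideal.Quotient.mk_surjective (I := p0)) τ
  refine ⟨s, ?_, ?_⟩
  · intro hs
    apply hτ
    have hs' : s ∈ q0 := hs
    rw [hq0, RingHom.mem_ker] at hs'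
    rw [hal, RingHom.mem_ker, coe_eval₂Hom, MvPolynomial.eval₂_map]
    exact hs'
  · rw [← map_mul, ← Ideal.map_ofList, ← Ideal.mem_comap, Ideal.comap_map_of_surjective
      (MvPolynomial.map (σ := Fin m) (Ideal.Quotient.mk p0))
      (MvPolynomial.map_surjective (Ideal.Quotient.mk p0) Ideal.Quotient.mk_surjective)] at hτb
    have e : Ideal.comap (MvPolynomial.map (σ := Fin m) (Ideal.Quotient.mk p0)) ⊥ =
        p0.map (algebraMap R (MvPolynomial (Fin m) R)) := by
      have := MvPolynomial.ker_map (σ := Fin m) (Ideal.Quotient.mk p0)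
      rw [Ideal.mk_ker] at this
      exact this
    rwa [e, sup_comm] at hτb
end

section
/-- evaluation of integer polynomials in the variables indexed by a finite subset. -/
noncomputable def rhoF {V : Type*} [CommRing V] (S : Finset V) : MvPolynomial S ℤ →+* V :=
  MvPolynomial.eval₂Hom (Int.castRingHom V) (fun s => (s : V))

theorem exists_lift_list {V : Type*} [CommRing V] {m : ℕ} (F : List (MvPolynomial (Fin m) V)) :
    ∃ (S : Finset V) (F0 : List (MvPolynomial (Fin m) (MvPolynomial S ℤ))),
      F = F0.map (MvPolynomial.map (rhoF S)) := by
  classical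
  refine ⟨F.toFinset.biUnion MvPolynomial.coeffs, ?_⟩
  set S := F.toFinset.biUnion MvPolynomial.coeffs
  have : ∀ f ∈ F, f ∈ Set.range (MvPolynomial.map (σ := Fin m) (rhoF S)) := by
    intro f hf
    refine MvPolynomial.mem_range_map_iff_coeffs_subset.2 ?_
    intro c hc
    refine ⟨MvPolynomial.X ⟨c, Finset.mem_biUnion.2 ⟨f, by simpa using hf, hc⟩⟩, by simp [rhoF]⟩
  have h2 : ∃ F0, List.map (MvPolynomial.map (σ := Fin m) (rhoF S)) F0 = F := by
    have h3 : F ∈ Set.range (List.map (MvPolynomial.map (σ := Fin m) (rhoF S))) := by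
      rw [Set.range_list_map]; exact this
    exact h3
  obtain ⟨F0, h⟩ := h2
  exact ⟨F0, h.symm⟩

theorem spread {V V' : Type*} [CommRing V] [IsDomain V] [ValuationRing V] [CommRing V']
    [IsDomain V'] [IsLocalRing V'] [Algebra V V'] (hinj : Function.Injective (algebraMap V V'))
    {m : ℕ} (F : List (MvPolynomial (Fin m) V))
    (hreg : ∀ l₁ f l₂, F = l₁ ++ f :: l₂ → ∀ c, f * c ∈ Ideal.ofList l₁ → c ∈ Ideal.ofList l₁)
    (Φ : MvPolynomial (Fin m) V →ₐ[V] V') (hΦ : ∀ g, Φ g = 0 ↔ g ∈ Ideal.ofList F) :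
    ∃ (S : Finset V) (F0 : List (MvPolynomial (Fin m) (MvPolynomial S ℤ)))
      (h : MvPolynomial (Fin m) (MvPolynomial S ℤ)),
      F = F0.map (MvPolynomial.map (rhoF S)) ∧ IsUnit (Φ (MvPolynomial.map (rhoF S) h)) ∧
      CP (MvPolynomial S ℤ) (Submonoid.powers h) (Ideal.ofList F0) ∧
      ∀ l₁ f l₂, F0 = l₁ ++ f :: l₂ →
        CP (MvPolynomial S ℤ) (Submonoid.powers h) (Ideal.ofList l₁) ∧
        Gd (MvPolynomial S ℤ) (Submonoid.powers h) (Ideal.ofList l₁) f ⊥ := by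
  obtain ⟨S, F0, hF0⟩ := exists_lift_list F
  let R := MvPolynomial S ℤ
  let k := IsLocalRing.ResidueField V'
  let ε : V →+* k := (IsLocalRing.residue V').comp (algebraMap V V')
  let x : Fin m → k := fun i => IsLocalRing.residue V' (Φ (MvPolynomial.X i))
  let q : Ideal (MvPolynomial (Fin m) V) := RingHom.ker (MvPolynomial.eval₂Hom ε x)
  let q0 : Ideal (MvPolynomial (Fin m) R) := RingHom.ker (MvPolynomial.eval₂Hom (ε.comp (rhoF S)) x)
  have hqp : q.IsPrime := RingHom.ker_isPrime _
  have hq0p : q0.IsPrime := RingHom.ker_isPrime _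
  have hev : ∀ g, MvPolynomial.eval₂Hom ε x g = IsLocalRing.residue V' (Φ g) := by
    have : MvPolynomial.eval₂Hom ε x = (IsLocalRing.residue V').comp (Φ : MvPolynomial (Fin m) V →+* V') := by
      refine MvPolynomial.ringHom_ext (fun r => ?_) (fun i => ?_)
      · simp only [MvPolynomial.eval₂Hom_C, ε, RingHom.comp_apply, RingHom.coe_coe]
        rw [← MvPolynomial.algebraMap_eq, AlgHom.commutes]
      · simp [x]
    intro g; rw [this]; rfl
  have hFq : ∀ f ∈ F, f ∈ q := by
    intro f hf
    rw [RingHom.mem_ker, hev, (hΦ f).2 (Ideal.subset_span hf), map_zero]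
  have htf : ∀ t : V, t ≠ 0 → ∀ g, MvPolynomial.C t * g ∈ Ideal.ofList F → g ∈ Ideal.ofList F := by
    intro t ht g hg
    rw [← hΦ] at hg ⊢
    rw [map_mul, ← MvPolynomial.algebraMap_eq, AlgHom.commutes] at hg
    rcases mul_eq_zero.1 hg with h | h
    · exact absurd ((injective_iff_map_eq_zero _).1 hinj t h) ht
    · exact h
  have hfib := fibre_Gd q F hFq hreg htf
  have hdesc : ∀ l₁ f l₂, F0 = l₁ ++ f :: l₂ →
      Gd R q0.primeCompl (⊥ ⊔ Ideal.ofList l₁) f (q0.comap (algebraMap R _)) := by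
    intro l₁ f l₂ hl
    rw [bot_sup_eq]
    refine descent (rhoF S) ε x q q0 rfl rfl l₁ f ?_
    exact hfib _ _ (l₂.map (MvPolynomial.map (rhoF S))) (by rw [hF0, hl]; simp)
  have hU := Ulist (R := R) (B := MvPolynomial (Fin m) R)
    (fun J _ K hJK => genTor_mvPolynomial J m K hJK) q0 F0 ⊥ 1
    (fun h1 => hq0p.ne_top ((Ideal.eq_top_iff_one _).2 h1)) (CP.mvPolynomial _) hdesc
  simp only [bot_sup_eq] at hU
  obtain ⟨h, hh, -, h1, h2⟩ := hU
  refine ⟨S, F0, h, hF0, ?_, h1, fun l₁ f l₂ hl => ⟨(h2 l₁ f l₂ hl).1, (h2 l₁ f l₂ hl).2 ⊥⟩⟩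
  rw [← IsLocalRing.residue_ne_zero_iff_isUnit, ← hev]
  intro h0
  apply hh
  rw [RingHom.mem_ker, ← h0, MvPolynomial.coe_eval₂Hom, MvPolynomial.coe_eval₂Hom, MvPolynomial.eval₂_map]
end

section
section
open TensorProduct Algebra.TensorProduct
variable {R H C : Type*} [CommRing R] [CommRing H] [CommRing C] [Algebra R H] [Algebra R C]

theorem append_split {α : Type*} {A B l₁ l₂ : List α} {f : α} (h : A ++ B = l₁ ++ f :: l₂) :
    (∃ a, A = l₁ ++ f :: a) ∨ ∃ b, l₁ = A ++ b ∧ B = b ++ f :: l₂ := by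
  rcases List.append_eq_append_iff.1 h with ⟨a, h1, h2⟩ | ⟨a, h1, h2⟩
  · exact Or.inr ⟨a, h1, h2⟩
  · cases a with
    | nil => exact Or.inr ⟨[], by simpa using h1.symm, by simpa using h2.symm⟩
    | cons b a =>
      simp only [List.cons_append, List.cons.injEq] at h2
      obtain ⟨rfl, h2⟩ := h2
      exact Or.inl ⟨a, h1⟩

theorem wr_tensor [Module.Flat R C] (Q : List H) (hQ : RingTheory.Sequence.IsWeaklyRegular H Q)
    (F : List C) (hF : ∀ l₁ f l₂, F = l₁ ++ f :: l₂ →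
      (∀ c, f * c ∈ Ideal.ofList l₁ → c ∈ Ideal.ofList l₁) ∧
      Module.Flat R (C ⧸ Ideal.ofList l₁ ⊔ Ideal.span {f})) :
    RingTheory.Sequence.IsWeaklyRegular (H ⊗[R] C)
      (Q.map (includeLeft : H →ₐ[R] H ⊗[R] C) ++ F.map (includeRight : C →ₐ[R] H ⊗[R] C)) := by
  rw [wr_iff]
  intro l₁ f l₂ hl c hc
  rcases append_split hl with ⟨a, ha⟩ | ⟨b, rfl, hb⟩
  · have h1 : RingTheory.Sequence.IsWeaklyRegular (H ⊗[R] C) (Q.map (algebraMap H (H ⊗[R] C))) :=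
      hQ.of_flat
    exact (wr_iff _).1 h1 l₁ f a ha c hc
  · obtain ⟨u₁, u₂, hFu, rfl, hu'⟩ := List.map_eq_append_iff.1 hb
    obtain ⟨g, u₂, rfl, rfl, rfl⟩ := List.map_eq_cons_iff.1 hu'
    obtain ⟨h1, h2⟩ := hF _ _ _ hFu
    let N := H ⧸ Ideal.ofList Q
    let μ : H ⊗[R] C →ₐ[R] N ⊗[R] C :=
      Algebra.TensorProduct.map (Ideal.Quotient.mkₐ R (Ideal.ofList Q)) (AlgHom.id R C)
    have hμs : Function.Surjective μ :=
      Algebra.TensorProduct.map_surjective _ _ (Ideal.Quotient.mkₐ_surjective _ _) Function.surjective_id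
    have hker : RingHom.ker μ = (Ideal.ofList Q).map (includeLeft : H →ₐ[R] H ⊗[R] C) := by
      have := Algebra.TensorProduct.rTensor_ker (R := R) (S := R) (C := C) (Ideal.Quotient.mkₐ R (Ideal.ofList Q))
        (Ideal.Quotient.mkₐ_surjective _ _)
      have e : RingHom.ker (Ideal.Quotient.mkₐ R (Ideal.ofList Q)) = Ideal.ofList Q :=
        Ideal.Quotient.mkₐ_ker R _
      rw [e] at this
      exact this
    have eQ : Ideal.ofList (Q.map (includeLeft : H →ₐ[R] H ⊗[R] C)) = RingHom.ker μ := by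
      rw [hker]; exact (Ideal.map_ofList (includeLeft : H →ₐ[R] H ⊗[R] C).toRingHom Q).symm
    have eu : Ideal.ofList (u₁.map (includeRight : C →ₐ[R] H ⊗[R] C)) =
        (Ideal.ofList u₁).map (includeRight : C →ₐ[R] H ⊗[R] C) :=
      (Ideal.map_ofList (includeRight : C →ₐ[R] H ⊗[R] C).toRingHom u₁).symm
    rw [Ideal.ofList_append, eQ, eu] at hc ⊢
    have hcomp : ∀ J : Ideal C, (J.map (includeRight : C →ₐ[R] H ⊗[R] C)).map μ =
        J.map (includeRight : C →ₐ[R] N ⊗[R] C) := by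
      intro J
      have : (includeRight : C →ₐ[R] N ⊗[R] C) = μ.comp includeRight := by
        ext c; simp [μ]
      rw [this]
      exact Ideal.map_map (includeRight : C →ₐ[R] H ⊗[R] C).toRingHom μ.toRingHom
    have hc' := Ideal.mem_map_of_mem μ hc
    have hk0 : (RingHom.ker μ).map μ = ⊥ := by
      rw [Ideal.map_eq_bot_iff_le_ker]
    rw [Ideal.map_sup, hk0, bot_sup_eq, hcomp, map_mul] at hc'
    have hμf : μ (includeRight g) = (1 : N) ⊗ₜ[R] g := by simp [μ]
    rw [hμf] at hc'
    have key := reg_tensor (R := R) (Ideal.ofList u₁) g h1 N (μ c) hc'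
    rw [← hcomp] at key
    have key2 : c ∈ Ideal.comap μ (Ideal.map μ ((Ideal.ofList u₁).map (includeRight : C →ₐ[R] H ⊗[R] C))) := key
    rw [Ideal.comap_map_of_surjective _ hμs, sup_comm] at key2
    exact key2
end
end

section
section
open TensorProduct Algebra.TensorProduct

theorem ker_tensor {R H A W C V' : Type*} [CommRing R] [CommRing H] [CommRing A] [CommRing W]
    [CommRing C] [CommRing V'] [Algebra R H] [Algebra R A] [Algebra R W] [Algebra R C] [Algebra R V']
    (π : H →ₐ[R] A) (hπ : Function.Surjective π) (ι : A →ₐ[R] W) (hι : Function.Injective ι)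
    (I : Ideal C) [Module.Flat R (C ⧸ I)] (θ : W ⊗[R] (C ⧸ I) →ₐ[R] V') (hθ : Function.Injective θ) :
    RingHom.ker (θ.comp ((Algebra.TensorProduct.map ι (AlgHom.id R (C ⧸ I))).comp
      (Algebra.TensorProduct.map π (Ideal.Quotient.mkₐ R I)))) =
    (RingHom.ker π).map (includeLeft : H →ₐ[R] H ⊗[R] C) ⊔
      I.map (includeRight : C →ₐ[R] H ⊗[R] C) := by
  have h1 := Algebra.TensorProduct.map_ker (R := R) (S := R) π (Ideal.Quotient.mkₐ R I) hπ
    (Ideal.Quotient.mkₐ_surjective R I)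
  have e : RingHom.ker (Ideal.Quotient.mkₐ R I) = I := Ideal.Quotient.mkₐ_ker R I
  rw [e] at h1
  rw [← h1]
  have h2 : Function.Injective (Algebra.TensorProduct.map ι (AlgHom.id R (C ⧸ I))) :=
    Module.Flat.rTensor_preserves_injective_linearMap (M := C ⧸ I) ι.toLinearMap hι
  ext z
  rw [RingHom.mem_ker, RingHom.mem_ker, AlgHom.comp_apply, AlgHom.comp_apply,
    map_eq_zero_iff θ hθ, map_eq_zero_iff _ h2]

theorem exists_theta {R W V' : Type*} [CommRing R] [CommRing W] [CommRing V'] [Algebra R W]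
    [Algebra W V'] [Algebra R V'] [IsScalarTower R W V'] {m : ℕ}
    (Φ : MvPolynomial (Fin m) W →ₐ[W] V') (F0 : List (MvPolynomial (Fin m) R))
    (hΦ : ∀ g, Φ g = 0 ↔ g ∈ Ideal.ofList (F0.map (MvPolynomial.map (algebraMap R W))))
    (h : MvPolynomial (Fin m) R) (hh : IsUnit (Φ (MvPolynomial.map (algebraMap R W) h)))
    (C : Type*) [CommRing C] [Algebra (MvPolynomial (Fin m) R) C] [Algebra R C]
    [IsScalarTower R (MvPolynomial (Fin m) R) C] [IsLocalization.Away h C]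
    (I : Ideal C) (hI : I = Ideal.ofList (F0.map (algebraMap (MvPolynomial (Fin m) R) C))) :
    ∃ θ : W ⊗[R] (C ⧸ I) →ₐ[R] V', Function.Injective θ ∧
      (∀ w, θ (w ⊗ₜ 1) = algebraMap W V' w) ∧
      ∀ i, θ (1 ⊗ₜ (Ideal.Quotient.mk I (algebraMap (MvPolynomial (Fin m) R) C (MvPolynomial.X i)))) = Φ (MvPolynomial.X i) := by
  let B := MvPolynomial (Fin m) R
  let τ : B →+* V' := (Φ : MvPolynomial (Fin m) W →+* V').comp (MvPolynomial.map (algebraMap R W))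
  have hτ : ∀ b, τ b = Φ (MvPolynomial.map (algebraMap R W) b) := fun b => rfl
  have hτR : ∀ r, τ (MvPolynomial.C r) = algebraMap R V' r := by
    intro r
    rw [hτ, MvPolynomial.map_C, ← MvPolynomial.algebraMap_eq, AlgHom.commutes,
      ← IsScalarTower.algebraMap_apply]
  let χ : C →+* V' := IsLocalization.Away.lift h (g := τ) hh
  have hχ : ∀ b, χ (algebraMap B C b) = τ b := fun b => IsLocalization.Away.lift_eq h hh b
  have hχI : ∀ c ∈ I, χ c = 0 := by
    intro c hc
    have : I ≤ RingHom.ker χ := by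
      rw [hI, Ideal.ofList, Ideal.span_le]
      intro c hc
      obtain ⟨f, hf, rfl⟩ := List.mem_map.1 hc
      change χ _ = 0
      rw [hχ, hτ, hΦ]
      exact Ideal.subset_span (List.mem_map_of_mem hf)
    exact this hc
  let χR : (C ⧸ I) →ₐ[R] V' :=
    { Ideal.Quotient.lift I χ hχI with
      commutes' := by
        intro r
        change χ (algebraMap R C r) = _
        rw [IsScalarTower.algebraMap_apply R B C, hχ]
        exact hτR r }
  have hχR : ∀ b : B, χR (Ideal.Quotient.mk I (algebraMap B C b)) = τ b := fun b => hχ b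
  let θ : W ⊗[R] (C ⧸ I) →ₐ[R] V' := Algebra.TensorProduct.productMap (IsScalarTower.toAlgHom R W V') χR
  have hθ : ∀ w t, θ (w ⊗ₜ t) = algebraMap W V' w * χR t := fun w t => by
    simp [θ]
  have hθw : ∀ w, θ (w ⊗ₜ 1) = algebraMap W V' w := fun w => by rw [hθ, map_one, mul_one]
  have hθX : ∀ i, θ (1 ⊗ₜ (Ideal.Quotient.mk I (algebraMap (MvPolynomial (Fin m) R) C (MvPolynomial.X i)))) =
      Φ (MvPolynomial.X i) := fun i => by
    rw [hθ, map_one, one_mul, hχR, hτ, MvPolynomial.map_X]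
  refine ⟨θ, ?_, hθw, hθX⟩
  -- injectivity
  let γ : B → W ⊗[R] (C ⧸ I) := fun b => 1 ⊗ₜ (Ideal.Quotient.mk I (algebraMap B C b))
  let δ : MvPolynomial (Fin m) W →ₐ[W] W ⊗[R] (C ⧸ I) :=
    MvPolynomial.aeval fun i => γ (MvPolynomial.X i)
  have hθδ : ∀ g, θ (δ g) = Φ g := by
    have : (θ : W ⊗[R] (C ⧸ I) →+* V').comp (δ : MvPolynomial (Fin m) W →+* W ⊗[R] (C ⧸ I)) =
        (Φ : MvPolynomial (Fin m) W →+* V') := by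
      refine MvPolynomial.ringHom_ext (fun r => ?_) (fun i => ?_)
      · simp only [RingHom.comp_apply, RingHom.coe_coe]
        rw [← MvPolynomial.algebraMap_eq, AlgHom.commutes, AlgHom.commutes]
        exact hθw r
      · simp only [RingHom.comp_apply, RingHom.coe_coe]
        rw [MvPolynomial.aeval_X]
        exact hθX i
    intro g
    exact congrArg (fun F => F g) this
  have hδ : ∀ b : B, δ (MvPolynomial.map (algebraMap R W) b) = γ b := by
    have : (δ : MvPolynomial (Fin m) W →+* W ⊗[R] (C ⧸ I)).comp (MvPolynomial.map (algebraMap R W)) =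
        (includeRight : (C ⧸ I) →ₐ[R] W ⊗[R] (C ⧸ I)).toRingHom.comp
          ((Ideal.Quotient.mk I).comp (algebraMap B C)) := by
      refine MvPolynomial.ringHom_ext (fun r => ?_) (fun i => ?_)
      · simp only [RingHom.comp_apply, RingHom.coe_coe, MvPolynomial.map_C]
        rw [← MvPolynomial.algebraMap_eq, ← MvPolynomial.algebraMap_eq, AlgHom.commutes,
          ← IsScalarTower.algebraMap_apply R B C]
        have e : Ideal.Quotient.mk I (algebraMap R C r) = algebraMap R (C ⧸ I) r := rfl
        rw [e]
        change algebraMap R W r ⊗ₜ 1 = (includeRight : (C ⧸ I) →ₐ[R] W ⊗[R] (C ⧸ I)) _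
        rw [AlgHom.commutes]
        rfl
      · simp only [RingHom.comp_apply, RingHom.coe_coe, MvPolynomial.map_X]
        rw [MvPolynomial.aeval_X]
        rfl
    intro b
    exact congrArg (fun F => F b) this
  have hγm : ∀ a b, γ (a * b) = γ a * γ b := fun a b => by
    rw [← hδ, ← hδ, ← hδ, map_mul, map_mul]
  have hγu : IsUnit (γ h) := by
    have := ((IsLocalization.Away.algebraMap_isUnit (S := C) h).map (Ideal.Quotient.mk I)).map
      (includeRight : (C ⧸ I) →ₐ[R] W ⊗[R] (C ⧸ I))
    exact this
  have hsurj : ∀ z : W ⊗[R] (C ⧸ I), ∃ (n : ℕ) (g : MvPolynomial (Fin m) W), γ h ^ n * z = δ g := by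
    intro z
    induction z with
    | zero => exact ⟨0, 0, by simp⟩
    | tmul w t =>
      obtain ⟨c, rfl⟩ := Ideal.Quotient.mk_surjective t
      obtain ⟨n, b, hb⟩ := IsLocalization.Away.surj h c
      refine ⟨n, MvPolynomial.C w * MvPolynomial.map (algebraMap R W) b, ?_⟩
      rw [map_mul, hδ, ← MvPolynomial.algebraMap_eq, AlgHom.commutes]
      change (1 ⊗ₜ (Ideal.Quotient.mk I (algebraMap B C h))) ^ n * (w ⊗ₜ[R] _) =
        (w ⊗ₜ[R] 1) * (1 ⊗ₜ (Ideal.Quotient.mk I (algebraMap B C b)))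
      rw [← hb, Algebra.TensorProduct.tmul_pow, Algebra.TensorProduct.tmul_mul_tmul,
        Algebra.TensorProduct.tmul_mul_tmul]
      simp [mul_comm]
      rfl
    | add z₁ z₂ h₁ h₂ =>
      obtain ⟨n₁, g₁, e₁⟩ := h₁
      obtain ⟨n₂, g₂, e₂⟩ := h₂
      refine ⟨n₁ + n₂, MvPolynomial.map (algebraMap R W) h ^ n₂ * g₁ +
        MvPolynomial.map (algebraMap R W) h ^ n₁ * g₂, ?_⟩
      rw [map_add, map_mul, map_mul, map_pow, map_pow, hδ, ← e₁, ← e₂, pow_add]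
      ring
  rw [injective_iff_map_eq_zero]
  intro z hz
  obtain ⟨n, g, hg⟩ := hsurj z
  have hg0 : Φ g = 0 := by rw [← hθδ, ← hg, map_mul, hz, mul_zero]
  rw [hΦ] at hg0
  have hle : Ideal.ofList (F0.map (MvPolynomial.map (algebraMap R W))) ≤ RingHom.ker δ := by
    rw [Ideal.ofList, Ideal.span_le]
    intro f' hf'
    obtain ⟨f, hf, rfl⟩ := List.mem_map.1 hf'
    change δ _ = 0
    rw [hδ]
    have : Ideal.Quotient.mk I (algebraMap B C f) = 0 := by
      rw [Ideal.Quotient.eq_zero_iff_mem, hI]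
      exact Ideal.subset_span (List.mem_map_of_mem hf)
    change 1 ⊗ₜ (Ideal.Quotient.mk I (algebraMap B C f)) = _
    rw [this, TensorProduct.tmul_zero]
  have hδ0 : δ g = 0 := hle hg0
  rw [hδ0] at hg
  exact ((hγu.pow n).mul_right_eq_zero).1 hg
end
end

section
theorem map_ofList_algHom {R A B : Type*} [CommRing R] [CommRing A] [CommRing B] [Algebra R A]
    [Algebra R B] (f : A →ₐ[R] B) (l : List A) :
    (Ideal.ofList l).map f = Ideal.ofList (l.map f) :=
  Ideal.map_ofList (f : A →+* B) l

/-- subalgebra which is the image of a smooth algebra with kernel a weakly regular sequence is CI -/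
theorem CI_range {V V' G : Type u} [CommRing V] [CommRing V'] [Nontrivial V'] [CommRing G]
    [Algebra V G] [Algebra V V'] [Algebra.Smooth V G] (P : List G)
    (hP : RingTheory.Sequence.IsWeaklyRegular G P) (Ψ : G →ₐ[V] V')
    (hΨ : RingHom.ker Ψ = Ideal.ofList P) : IsCompleteIntersectionAlgebra V Ψ.range := by
  refine ⟨G, inferInstance, inferInstance, P, inferInstance, ⟨hP, ?_⟩, ⟨?_⟩⟩
  · rw [Ideal.smul_top_eq_map, Algebra.algebraMap_self, Ideal.map_id, ← hΨ]
    intro h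
    have : (1 : G) ∈ RingHom.ker Ψ := by
      have h1 : (1 : G) ∈ (⊤ : Submodule G G) := trivial
      rw [h] at h1
      exact h1
    rw [RingHom.mem_ker, map_one] at this
    exact one_ne_zero this
  · have e : Ideal.span {x : G | x ∈ P} = RingHom.ker Ψ.rangeRestrict := by
      rw [AlgHom.ker_rangeRestrict, hΨ]
    exact (Ideal.quotientEquivAlgOfEq V e).trans
      (Ideal.quotientKerAlgEquivOfSurjective Ψ.rangeRestrict_surjective)

/-- unpack the definition of CI. -/
theorem CI_unpack {V V' : Type u} [CommRing V] [CommRing V']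
    [Algebra V V'] (T : Subalgebra V V') (h : IsCompleteIntersectionAlgebra V T) :
    ∃ (G : Type u) (_ : CommRing G) (_ : Algebra V G) (P : List G) (π : G →ₐ[V] T),
      Algebra.Smooth V G ∧ RingTheory.Sequence.IsRegular G P ∧ Function.Surjective π ∧
      RingHom.ker π = Ideal.ofList P := by
  obtain ⟨G, i1, i2, P, h1, h2, ⟨e⟩⟩ := h
  refine ⟨G, i1, i2, P, e.toAlgHom.comp (Ideal.Quotient.mkₐ V _), h1, h2,
    e.surjective.comp (Ideal.Quotient.mkₐ_surjective V _), ?_⟩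
  ext x
  rw [RingHom.mem_ker, AlgHom.comp_apply]
  change e _ = 0 ↔ _
  rw [map_eq_zero_iff e e.injective, Ideal.Quotient.mkₐ_eq_mk, Ideal.Quotient.eq_zero_iff_mem]

section
open TensorProduct Algebra.TensorProduct
theorem assemble {V W V' R : Type u} [CommRing V] [CommRing W] [CommRing V'] [CommRing R]
    [Nontrivial V'] [Algebra V W] [Algebra W V'] [Algebra V V'] [IsScalarTower V W V']
    [Algebra R W] [Algebra R V'] [IsScalarTower R W V']
    (A0 : Subalgebra V W) (hA0 : IsCompleteIntersectionAlgebra V A0)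
    (hlift : ∀ (H : Type u) [CommRing H] (p : H →+* W), (∀ a ∈ A0, a ∈ p.range) →
      ∃ η : R →+* H, p.comp η = algebraMap R W) {m : ℕ}
    (Φ : MvPolynomial (Fin m) W →ₐ[W] V') (F0 : List (MvPolynomial (Fin m) R))
    (hΦ : ∀ g, Φ g = 0 ↔ g ∈ Ideal.ofList (F0.map (MvPolynomial.map (algebraMap R W))))
    (h : MvPolynomial (Fin m) R) (hh : IsUnit (Φ (MvPolynomial.map (algebraMap R W) h)))
    (hCP : CP R (Submonoid.powers h) (Ideal.ofList F0))
    (hF0 : ∀ l₁ f l₂, F0 = l₁ ++ f :: l₂ → CP R (Submonoid.powers h) (Ideal.ofList l₁) ∧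
      Gd R (Submonoid.powers h) (Ideal.ofList l₁) f ⊥) :
    ∃ T : Subalgebra V V', IsCompleteIntersectionAlgebra V T ∧
      (∀ a ∈ A0, algebraMap W V' a ∈ T) ∧ ∀ i, Φ (MvPolynomial.X i) ∈ T := by
  obtain ⟨H, i1, i2, Q, π, hsm, hreg, hπs, hπk⟩ := CI_unpack A0 hA0
  obtain ⟨η, hη⟩ := hlift H ((algebraMap A0 W).comp (π : H →+* A0)) (by
    intro a ha
    obtain ⟨x, hx⟩ := hπs ⟨a, ha⟩
    exact ⟨x, by rw [RingHom.comp_apply, RingHom.coe_coe, hx]; rfl⟩)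
  let B := MvPolynomial (Fin m) R
  let C := Localization.Away h
  let _ : Algebra R H := η.toAlgebra
  let _ : Algebra R A0 := ((π : H →+* A0).comp η).toAlgebra
  let πR : H →ₐ[R] A0 := { (π : H →+* A0) with commutes' := fun r => rfl }
  let ιR : A0 →ₐ[R] W := { algebraMap A0 W with commutes' := fun r => congrArg (fun F => F r) hη }
  have hιR : Function.Injective ιR := Subtype.val_injective
  let I : Ideal C := Ideal.ofList (F0.map (algebraMap B C))
  obtain ⟨θ, hθi, hθw, hθX⟩ := exists_theta Φ F0 hΦ h hh C I rfl
  have hflat : ∀ l : List B, CP R (Submonoid.powers h) (Ideal.ofList l) →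
      Module.Flat R (C ⧸ Ideal.ofList (l.map (algebraMap B C))) := by
    intro l hl
    have := flat_of_CP h C (Ideal.ofList l) hl
    rwa [Ideal.map_ofList] at this
  have hfI : Module.Flat R (C ⧸ I) := hflat F0 hCP
  have hker := ker_tensor πR hπs ιR hιR I θ hθi
  have hfC : Module.Flat R C := Module.Flat.trans R B C
  have hwr := wr_tensor (R := R) Q hreg.toIsWeaklyRegular (F0.map (algebraMap B C)) (by
    intro l₁ f l₂ hl
    obtain ⟨k₁, k₂, hk, rfl, hk2⟩ := List.map_eq_append_iff.1 hl
    obtain ⟨f, k₂, rfl, rfl, rfl⟩ := List.map_eq_cons_iff.1 hk2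
    refine ⟨fun c hc => ?_, ?_⟩
    · rw [← Ideal.map_ofList] at hc ⊢
      exact reg_of_Gd h C _ f (hF0 _ _ _ hk).2 c hc
    · have e : Ideal.ofList (k₁.map (algebraMap B C)) ⊔ Ideal.span {algebraMap B C f} =
          Ideal.ofList ((k₁ ++ [f]).map (algebraMap B C)) := by
        rw [List.map_append, Ideal.ofList_append, List.map_singleton, Ideal.ofList_singleton]
      rw [e]
      refine hflat _ ?_
      cases k₂ with
      | nil => rw [← hk]; exact hCP
      | cons g k₂ => exact (hF0 (k₁ ++ [f]) g k₂ (by rw [hk]; simp)).1)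
  let G := H ⊗[R] C
  let Ψ0 := (θ.comp ((Algebra.TensorProduct.map ιR (AlgHom.id R (C ⧸ I))).comp
      (Algebra.TensorProduct.map πR (Ideal.Quotient.mkₐ R I))))
  have : IsScalarTower V H G := inferInstance
  have hΨ0 : ∀ x : H, Ψ0 (x ⊗ₜ 1) = algebraMap W V' (π x : W) := by
    intro x
    rw [← hθw]
    rfl
  let Ψ : G →ₐ[V] V' := { (Ψ0 : G →+* V') with
    commutes' := by
      intro v
      change Ψ0 (algebraMap V H v ⊗ₜ 1) = _
      rw [hΨ0, AlgHom.commutes, IsScalarTower.algebraMap_apply V W V']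
      rfl }
  have : Algebra.Smooth R B := { }
  have : Algebra.Smooth B C := Algebra.Smooth.of_isLocalization_Away h
  have : Algebra.Smooth R C := Algebra.Smooth.comp R B C
  have : Algebra.Smooth H G := inferInstance
  have : Algebra.Smooth V G := Algebra.Smooth.comp V H G
  refine ⟨Ψ.range, CI_range _ hwr Ψ ?_, ?_, ?_⟩
  · rw [Ideal.ofList_append]
    refine Eq.trans hker ?_
    have e : RingHom.ker πR = Ideal.ofList Q := hπk
    rw [e, map_ofList_algHom, map_ofList_algHom]
  · intro a ha
    obtain ⟨x, hx⟩ := hπs ⟨a, ha⟩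
    exact ⟨x ⊗ₜ 1, by
      change Ψ0 _ = _
      rw [hΨ0, hx]⟩
  · intro i
    refine ⟨1 ⊗ₜ (algebraMap B C (MvPolynomial.X i)), ?_⟩
    rw [← hθX]
    change θ (ιR (πR 1) ⊗ₜ _) = _
    rw [map_one, map_one]
    rfl
end
end

section
open RingTheory.Sequence

theorem lift_seq {E D : Type*} [CommRing E] [CommRing D] (q : E →+* D)
    (hq : Function.Surjective q) (F : List E) (hF : IsWeaklyRegular E F)
    (hk : RingHom.ker q = Ideal.ofList F) (P : List E) (hP : IsWeaklyRegular D (P.map q)) :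
    IsWeaklyRegular E (F ++ P) ∧
      (Ideal.ofList (P.map q)).comap q = Ideal.ofList (F ++ P) := by
  have key : ∀ l : List E, (Ideal.ofList (l.map q)).comap q = Ideal.ofList (F ++ l) := by
    intro l
    rw [← Ideal.map_ofList, Ideal.comap_map_of_surjective q hq, Ideal.ofList_append, sup_comm, ← hk]
    rfl
  refine ⟨?_, key P⟩
  rw [wr_iff] at hF hP ⊢
  intro l₁ f l₂ hl c hc
  rcases append_split hl with ⟨a, ha⟩ | ⟨b, rfl, hb⟩
  · exact hF l₁ f a ha c hc
  · rw [← key, Ideal.mem_comap] at hc ⊢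
    refine hP (b.map q) (q f) (l₂.map q) (by rw [hb]; simp) (q c) ?_
    rwa [← map_mul]

theorem wr_equiv {E D : Type*} [CommRing E] [CommRing D] (e : E ≃+* D) (L : List D)
    (hL : IsWeaklyRegular D L) : IsWeaklyRegular E (L.map e.symm) ∧
      (Ideal.ofList L).comap (e : E →+* D) = Ideal.ofList (L.map e.symm) := by
  have hmap : (L.map e.symm).map (e : E →+* D) = L := by
    rw [List.map_map]
    conv_rhs => rw [← List.map_id L]
    congr 1
    ext x
    simp
  have := lift_seq (e : E →+* D) e.surjective [] (by rw [wr_iff]; simp) (by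
    rw [Ideal.ofList_nil]
    exact (RingHom.injective_iff_ker_eq_bot (e : E →+* D)).1 e.injective) (L.map e.symm)
    (by rw [hmap]; exact hL)
  rw [hmap] at this
  exact this

open Polynomial in
theorem wr_std {B : Type*} [CommRing B] [IsDomain B] (f g : B[X]) (hf : f.Monic) :
    IsWeaklyRegular B[X][X] [C f, X * C g - 1] := by
  rw [wr_iff]
  intro l₁ p l₂ hl c hc
  match l₁, hl with
  | [], hl =>
    simp only [List.nil_append, List.cons.injEq] at hl
    obtain ⟨rfl, -⟩ := hl
    simp only [Ideal.ofList_nil, Ideal.mem_bot] at hc ⊢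
    rcases mul_eq_zero.1 hc with h | h
    · exact absurd (C_eq_zero.1 h) hf.ne_zero
    · exact h
  | [a], hl =>
    simp only [List.cons_append, List.nil_append, List.cons.injEq] at hl
    obtain ⟨rfl, rfl, -⟩ := hl
    have e : Ideal.ofList [C f] = (Ideal.span {f}).map (C : B[X] →+* B[X][X]) := by
      rw [Ideal.ofList_singleton, Ideal.map_span, Set.image_singleton]
    rw [e, Ideal.mem_map_C_iff] at hc ⊢
    intro n
    induction n with
    | zero =>
      have := hc 0
      simp only [sub_mul, one_mul, coeff_sub, mul_assoc, coeff_X_mul_zero, zero_sub] at this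
      exact (Ideal.neg_mem_iff _).1 this
    | succ n ih =>
      have := hc (n + 1)
      simp only [sub_mul, one_mul, coeff_sub, mul_assoc, coeff_X_mul, coeff_C_mul] at this
      exact (Submodule.sub_mem_iff_right _ (Ideal.mul_mem_left _ _ ih)).1 this
  | a :: b :: l, hl => simp at hl

theorem pres_std {A D : Type*} [CommRing A] [IsDomain A] [CommRing D] [Algebra A D] (n : ℕ)
    [Algebra (MvPolynomial (Fin n) A) D] [IsScalarTower A (MvPolynomial (Fin n) A) D]
    [Algebra.IsStandardEtale (MvPolynomial (Fin n) A) D] :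
    ∃ (m : ℕ) (F : List (MvPolynomial (Fin m) A)) (q : MvPolynomial (Fin m) A →ₐ[A] D),
      Function.Surjective q ∧ IsWeaklyRegular (MvPolynomial (Fin m) A) F ∧ RingHom.ker q = Ideal.ofList F := by
  obtain ⟨P⟩ := Algebra.IsStandardEtale.nonempty_standardEtalePresentation
    (R := MvPolynomial (Fin n) A) (S := D)
  let B := MvPolynomial (Fin n) A
  let e1 : MvPolynomial (Fin (n + 2)) A ≃ₐ[A] Polynomial (Polynomial B) :=
    (MvPolynomial.finSuccEquiv A (n + 1)).trans
      (Polynomial.mapAlgEquiv (MvPolynomial.finSuccEquiv A n))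
  let L : List (Polynomial (Polynomial B)) :=
    [Polynomial.C P.f, Polynomial.X * Polynomial.C P.g - 1]
  have hL : IsWeaklyRegular (Polynomial (Polynomial B)) L := wr_std P.f P.g P.monic_f
  let e2 : P.Ring ≃ₐ[B] D := P.equivRing.symm
  let q2 : Polynomial (Polynomial B) →+* D :=
    (e2 : P.Ring →+* D).comp (Ideal.Quotient.mk (Ideal.span {Polynomial.C P.f, Polynomial.X * Polynomial.C P.g - 1}))
  have hq2 : RingHom.ker q2 = Ideal.ofList L := by
    ext x
    rw [RingHom.mem_ker]
    change e2 _ = 0 ↔ _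
    rw [map_eq_zero_iff e2 e2.injective]
    have h0 : Ideal.Quotient.mk (Ideal.span
        {Polynomial.C P.f, Polynomial.X * Polynomial.C P.g - 1}) x = 0 ↔ _ :=
      Ideal.Quotient.eq_zero_iff_mem
    refine Iff.trans h0 ?_
    have : {x | x ∈ L} = {Polynomial.C P.f, Polynomial.X * Polynomial.C P.g - 1} := by
      ext; simp [L]
    rw [Ideal.ofList, this]
  let q : MvPolynomial (Fin (n + 2)) A →ₐ[A] D :=
    { q2.comp (e1 : MvPolynomial (Fin (n + 2)) A →+* Polynomial (Polynomial B)) with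
      commutes' := by
        intro r
        change q2 (e1 _) = _
        rw [AlgEquiv.commutes]
        change e2 (algebraMap B P.Ring (algebraMap A B r)) = _
        rw [AlgEquiv.commutes, ← IsScalarTower.algebraMap_apply A B D] }
  obtain ⟨h1, h2⟩ := wr_equiv e1.toRingEquiv L hL
  refine ⟨n + 2, _, q, ?_, h1, ?_⟩
  · exact (e2.surjective.comp Ideal.Quotient.mk_surjective).comp e1.surjective
  · rw [← h2, ← hq2]
    rfl

theorem pres_CI {A V' : Type u} [CommRing A] [IsDomain A] [CommRing V'] [IsLocalRing V']
    [Algebra A V'] (T : Subalgebra A V') (hT : IsCompleteIntersectionAlgebra A T) :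
    ∃ (m : ℕ) (F : List (MvPolynomial (Fin m) A)) (Φ : MvPolynomial (Fin m) A →ₐ[A] V'),
      IsWeaklyRegular (MvPolynomial (Fin m) A) F ∧ (∀ g, Φ g = 0 ↔ g ∈ Ideal.ofList F) ∧ T ≤ Φ.range := by
  obtain ⟨G, i1, i2, P, π, hsm, hreg, hπs, hπk⟩ := CI_unpack T hT
  let ψ : G →ₐ[A] V' := T.val.comp π
  have hψ : ∀ x, ψ x = 0 ↔ x ∈ Ideal.ofList P := by
    intro x
    rw [← hπk, RingHom.mem_ker]
    exact map_eq_zero_iff T.val Subtype.val_injective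
  let 𝔮 : Ideal G := (IsLocalRing.maximalIdeal V').comap ψ
  have : 𝔮.IsPrime := inferInstance
  obtain ⟨f, hf, n, i3, i4, i5⟩ := Algebra.IsSmoothAt.exists_isStandardEtale_mvPolynomial
    (R := A) (S := G) (p := 𝔮)
  have hfu : IsUnit (ψ f) := by
    by_contra h
    exact hf ((IsLocalRing.mem_maximalIdeal _).2 h)
  obtain ⟨m, F, q, hqs, hF, hqk⟩ := pres_std (A := A) (D := Localization.Away f) n
  let ψf : Localization.Away f →ₐ[A] V' := IsLocalization.Away.liftAlgHom (f := ψ) f hfu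
  have hψf : ∀ x, ψf (algebraMap G _ x) = ψ x := fun x => IsLocalization.Away.lift_eq f hfu x
  have hker : ∀ x, ψf x = 0 ↔ x ∈ Ideal.ofList (P.map (algebraMap G (Localization.Away f))) := by
    intro x
    rw [← Ideal.map_ofList]
    constructor
    · intro hx
      obtain ⟨k, g, hg⟩ := IsLocalization.Away.surj f x
      have h1 : ψ g = 0 := by rw [← hψf, ← hg, map_mul, hx, zero_mul]
      have h2 := Ideal.mem_map_of_mem (algebraMap G (Localization.Away f)) ((hψ g).1 h1)
      rw [← hg] at h2
      exact (Ideal.mul_unit_mem_iff_mem _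
        ((IsLocalization.Away.algebraMap_isUnit (S := Localization.Away f) f).pow k)).1 h2
    · intro hx
      have : (Ideal.ofList P).map (algebraMap G (Localization.Away f)) ≤ RingHom.ker ψf := by
        rw [Ideal.map_le_iff_le_comap]
        intro y hy
        rw [Ideal.mem_comap, RingHom.mem_ker, hψf]
        exact (hψ y).2 hy
      exact this hx
  have hPf : IsWeaklyRegular (Localization.Away f) (P.map (algebraMap G (Localization.Away f))) :=
    hreg.toIsWeaklyRegular.of_flat
  obtain ⟨P', hP'⟩ : ∃ P' : List (MvPolynomial (Fin m) A), P'.map (q : _ →+* Localization.Away f) =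
      P.map (algebraMap G (Localization.Away f)) := by
    have : P.map (algebraMap G (Localization.Away f)) ∈ Set.range
        (List.map (q : MvPolynomial (Fin m) A →+* Localization.Away f)) := by
      rw [Set.range_list_map]
      intro x _
      exact hqs x
    exact this
  obtain ⟨h1, h2⟩ := lift_seq (q : _ →+* Localization.Away f) hqs F hF hqk P' (by rw [hP']; exact hPf)
  refine ⟨m, F ++ P', ψf.comp q, h1, ?_, ?_⟩
  · intro g
    rw [← h2, hP', Ideal.mem_comap, ← hker]
    rfl
  · intro t ht
    obtain ⟨x, hx⟩ := hπs ⟨t, ht⟩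
    obtain ⟨y, hy⟩ := hqs (algebraMap G _ x)
    refine ⟨y, ?_⟩
    change ψf (q y) = t
    rw [hy, hψf]
    change ((π x : T) : V') = t
    rw [hx]
end


theorem CI_fg {V V' : Type u} [CommRing V] [CommRing V']
    [Algebra V V'] (T : Subalgebra V V') (h : IsCompleteIntersectionAlgebra V T) : T.FG := by
  obtain ⟨H, i1, i2, Q, π, hsm, hreg, hπs, hπk⟩ := CI_unpack T h
  have : Algebra.FiniteType V T := Algebra.FiniteType.of_surjective π hπs
  exact T.fg_iff_finiteType.2 this

theorem directed_finset {A B ι : Type*} [CommRing A] [CommRing B] [Algebra A B]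
    (S : ι → Subalgebra A B) (h0 : Nonempty ι)
    (h1 : ∀ i j : ι, ∃ k : ι, S i ≤ S k ∧ S j ≤ S k) (h2 : ∀ x : B, ∃ i : ι, x ∈ S i)
    (E : Finset B) : ∃ i, ∀ x ∈ E, x ∈ S i := by
  classical
  induction E using Finset.induction_on with
  | empty => exact ⟨h0.some, by simp⟩
  | insert a s _ ih =>
    obtain ⟨i, hi⟩ := ih
    obtain ⟨j, hj⟩ := h2 a
    obtain ⟨k, hk1, hk2⟩ := h1 i j
    refine ⟨k, fun x hx => ?_⟩
    rcases Finset.mem_insert.1 hx with rfl | hx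
    · exact hk2 hj
    · exact hk1 (hi x hx)

theorem filteredUnion_of_finset {V V' : Type u} [CommRing V] [CommRing V'] [Algebra V V']
    (h : ∀ E : Finset V', ∃ T : Subalgebra V V', IsCompleteIntersectionAlgebra V T ∧
      ∀ x ∈ E, x ∈ T) : IsFilteredUnionOfCISubalgebras V V' := by
  classical
  refine ⟨{T : Subalgebra V V' // IsCompleteIntersectionAlgebra V T}, fun T => T.1, ?_, ?_, ?_,
    fun T => T.2⟩
  · obtain ⟨T, hT, -⟩ := h ∅
    exact ⟨⟨T, hT⟩⟩
  · rintro ⟨T₁, h₁⟩ ⟨T₂, h₂⟩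
    obtain ⟨E₁, rfl⟩ := CI_fg T₁ h₁
    obtain ⟨E₂, rfl⟩ := CI_fg T₂ h₂
    obtain ⟨T, hT, hE⟩ := h (E₁ ∪ E₂)
    exact ⟨⟨T, hT⟩, Algebra.adjoin_le fun x hx => hE x (Finset.mem_union_left _ hx),
      Algebra.adjoin_le fun x hx => hE x (Finset.mem_union_right _ hx)⟩
  · intro x
    obtain ⟨T, hT, hE⟩ := h {x}
    exact ⟨⟨T, hT⟩, hE x (by simp)⟩

/-- **Transitivity of filtered unions of complete intersection subalgebras.**
Let `V ⊆ V'' ⊆ V'` be extensions of valuation rings.  If `V''` is a filtered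
union of its complete intersection `V`-subalgebras and `V'` is a filtered union
of its complete intersection `V''`-subalgebras, then `V'` is a filtered union of
its complete intersection `V`-subalgebras. -/
theorem filteredUnionCI_trans (V V'' V' : Type u)
    [CommRing V] [CommRing V''] [CommRing V']
    [IsDomain V] [IsDomain V''] [IsDomain V']
    [ValuationRing V] [ValuationRing V''] [ValuationRing V']
    [Algebra V V''] [Algebra V'' V'] [Algebra V V'] [IsScalarTower V V'' V']
    (hinj₁ : Function.Injective (algebraMap V V''))
    (hinj₂ : Function.Injective (algebraMap V'' V'))
    (h₁ : IsFilteredUnionOfCISubalgebras V V'')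
    (h₂ : IsFilteredUnionOfCISubalgebras V'' V') :
    IsFilteredUnionOfCISubalgebras V V' := by
  classical
  apply filteredUnion_of_finset
  intro E
  obtain ⟨ι₂, S₂, a₂, b₂, c₂, d₂⟩ := h₂
  obtain ⟨ι₁, S₁, a₁, b₁, c₁, d₁⟩ := h₁
  obtain ⟨j, hj⟩ := directed_finset S₂ a₂ b₂ c₂ E
  obtain ⟨m, F, Φ, hF, hΦ, hT⟩ := pres_CI (S₂ j) (d₂ j)
  have hE : ∀ x ∈ E, ∃ g, Φ g = x := fun x hx => hT (hj x hx)
  choose! γ hγ using hE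
  obtain ⟨S, F0, h, rfl, hh, hCP, hF0⟩ := spread hinj₂ F ((wr_iff F).1 hF) Φ hΦ
  obtain ⟨i, hi⟩ := directed_finset S₁ a₁ b₁ c₁
    (S ∪ E.biUnion fun x => (γ x).coeffs)
  let R := MvPolynomial S ℤ
  letI : Algebra R V'' := (rhoF S).toAlgebra
  letI : Algebra R V' := ((algebraMap V'' V').comp (rhoF S)).toAlgebra
  haveI : IsScalarTower R V'' V' := IsScalarTower.of_algebraMap_eq fun _ => rfl
  obtain ⟨T, hT1, hT2, hT3⟩ := assemble (V := V) (R := R) (S₁ i) (d₁ i) (by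
    intro H _ p hp
    have hs : ∀ s : S, ∃ x : H, p x = s := fun s =>
      hp s (hi s (Finset.mem_union_left _ s.2))
    choose ξ hξ using hs
    refine ⟨MvPolynomial.eval₂Hom (Int.castRingHom H) ξ, ?_⟩
    refine MvPolynomial.ringHom_ext (fun r => by simp) (fun s => ?_)
    rw [RingHom.comp_apply, MvPolynomial.eval₂Hom_X', hξ]
    change _ = rhoF S _
    rw [rhoF, MvPolynomial.eval₂Hom_X']) Φ F0 hΦ h hh hCP hF0
  refine ⟨T, hT1, fun x hx => ?_⟩
  rw [← hγ x hx]
  have e := congrArg Φ (MvPolynomial.as_sum (γ x))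
  rw [e, map_sum]
  refine Subalgebra.sum_mem _ fun d hd => ?_
  rw [MvPolynomial.monomial_eq, map_mul, ← MvPolynomial.algebraMap_eq, AlgHom.commutes,
    Finsupp.prod, map_prod]
  refine Subalgebra.mul_mem _ (hT2 _ (hi _ (Finset.mem_union_right _ (Finset.mem_biUnion.2
    ⟨x, hx, ?_⟩)))) (Subalgebra.prod_mem _ fun k _ => ?_)
  · exact MvPolynomial.coeff_mem_coeffs _ (MvPolynomial.mem_support_iff.1 hd)
  · rw [map_pow]
    exact Subalgebra.pow_mem _ (hT3 k) _
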